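/- arXiv:2210.07859 — 9 statements merged into one kernel-verified Lean document; each statement's English description precedes it below -/
import Mathlib

section
/- For every fixed α ∈ (0,1), the function g(β) := 1/v(β) = (β+1)/(β−1) + ((1−α)/(1+α))·[ (β+3)/(2(β−1)) + (β(β+1)/(β−1)²)·(s_+ − s_−) + C·s_− ] is strictly convex on the interval (1, 1/α) and tends to +∞ as β ↓ 1 and as β ↑ 1/α. Consequently v = 1/g is a unimodal function of β: there is a unique β_max ∈ (1, 1/α) such that v is strictly increasing on (1, β_max] and strictly decreasing on [β_max, 1/α). -/
open Filter Topology Set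

/-- The reciprocal of a nonconstant affine function is strictly convex where that function is
positive. -/
theorem strictConvexOn_inv_affine {p q : ℝ} (hp : p ≠ 0) {s : Set ℝ} (hs : Convex ℝ s)
    (hpos : ∀ x ∈ s, 0 < p * x + q) : StrictConvexOn ℝ s fun x => (p * x + q)⁻¹ := by
  have hinv := strictConvexOn_zpow (m := -1) (by norm_num) (by norm_num)
  simp only [zpow_neg_one] at hinv
  refine ⟨hs, fun x hx y hy hxy a b ha hb hab => ?_⟩
  have hne : p * x + q ≠ p * y + q := fun h =>
    hxy (mul_left_cancel₀ hp (add_right_cancel h))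
  have key := hinv.2 (hpos x hx) (hpos y hy) hne ha hb hab
  have hcomb : a • (p * x + q) + b • (p * y + q) = p * (a • x + b • y) + q := by
    simp only [smul_eq_mul]
    linear_combination q * hab
  rwa [hcomb] at key

theorem convexOn_inv_sub {c : ℝ} {s : Set ℝ} (hs : Convex ℝ s) (hc : ∀ x ∈ s, c < x) :
    ConvexOn ℝ s fun x => (x - c)⁻¹ := by
  have h := strictConvexOn_inv_affine (p := 1) (q := -c) one_ne_zero hs
    fun x hx => by linarith [hc x hx]
  simpa only [one_mul, ← sub_eq_add_neg] using h.convexOn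

theorem convexOn_inv_sub_mul_inv_sub {c d : ℝ} {s : Set ℝ} (hs : Convex ℝ s)
    (hc : ∀ x ∈ s, c < x) (hd : ∀ x ∈ s, d < x) :
    ConvexOn ℝ s fun x => (x - c)⁻¹ * (x - d)⁻¹ := by
  have anti : ∀ e : ℝ, (∀ x ∈ s, e < x) → AntitoneOn (fun x => (x - e)⁻¹) s :=
    fun e he x hx y _ hxy => inv_anti₀ (sub_pos.2 (he x hx)) (by linarith)
  exact (convexOn_inv_sub hs hc).mul (convexOn_inv_sub hs hd)
    (fun x hx => inv_nonneg.2 (sub_pos.2 (hc x hx)).le)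
    (fun x hx => inv_nonneg.2 (sub_pos.2 (hd x hx)).le)
    ((anti c hc).monovaryOn (anti d hd))

theorem tendsto_inv_sub_nhdsGT (c : ℝ) :
    Tendsto (fun x : ℝ => (x - c)⁻¹) (𝓝[>] c) atTop := by
  refine Tendsto.inv_tendsto_nhdsGT_zero (f := fun x => x - c) ?_
  refine tendsto_nhdsWithin_iff.2 ⟨?_, ?_⟩
  · have h : Tendsto (fun x : ℝ => x - c) (𝓝 c) (𝓝 (c - c)) :=
      (continuous_id.sub continuous_const).tendsto c
    rw [sub_self] at h
    exact h.mono_left nhdsWithin_le_nhds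
  · filter_upwards [self_mem_nhdsWithin] with x hx using sub_pos.2 (mem_Ioi.1 hx)

theorem tendsto_inv_one_sub_mul_nhdsLT {a : ℝ} (ha : 0 < a) :
    Tendsto (fun x : ℝ => (1 - a * x)⁻¹) (𝓝[<] (1 / a)) atTop := by
  refine Tendsto.inv_tendsto_nhdsGT_zero (f := fun x => 1 - a * x) ?_
  refine tendsto_nhdsWithin_iff.2 ⟨?_, ?_⟩
  · have h : Tendsto (fun x : ℝ => 1 - a * x) (𝓝 (1 / a)) (𝓝 (1 - a * (1 / a))) :=
      (continuous_const.sub (continuous_const.mul continuous_id)).tendsto _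
    rw [mul_one_div_cancel ha.ne', sub_self] at h
    exact h.mono_left nhdsWithin_le_nhds
  · filter_upwards [self_mem_nhdsWithin] with x hx
    have h := (lt_div_iff₀ ha).1 (mem_Iio.1 hx)
    rw [mul_comm] at h
    exact sub_pos.2 h

theorem exists_isMinOn_Ioo_of_tendsto_atTop {f : ℝ → ℝ} {a b : ℝ} (hab : a < b)
    (hf : ContinuousOn f (Ioo a b)) (ha : Tendsto f (𝓝[>] a) atTop)
    (hb : Tendsto f (𝓝[<] b) atTop) : ∃ m ∈ Ioo a b, IsMinOn f (Ioo a b) m := by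
  obtain ⟨c, hc⟩ := exists_between hab
  obtain ⟨a', ha', hfa⟩ := (mem_nhdsGT_iff_exists_Ioo_subset' hc.1).1
    (ha.eventually_gt_atTop (f c))
  obtain ⟨b', hb', hfb⟩ := (mem_nhdsLT_iff_exists_Ioo_subset' hc.2).1
    (hb.eventually_gt_atTop (f c))
  have hac : a' ≤ c := le_of_not_gt fun h => lt_irrefl (f c) (hfa ⟨hc.1, h⟩)
  have hcb : c ≤ b' := le_of_not_gt fun h => lt_irrefl (f c) (hfb ⟨h, hc.2⟩)
  have hsub : Icc a' b' ⊆ Ioo a b := Icc_subset_Ioo ha' hb'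
  obtain ⟨m, hm, hmin⟩ := isCompact_Icc.exists_isMinOn ⟨c, hac, hcb⟩ (hf.mono hsub)
  refine ⟨m, hsub hm, isMinOn_iff.2 fun x hx => ?_⟩
  have hmc : f m ≤ f c := hmin ⟨hac, hcb⟩
  rcases lt_or_ge x a' with h | h
  · exact hmc.trans (hfa ⟨hx.1, h⟩ : f c < f x).le
  rcases lt_or_ge b' x with h' | h'
  · exact hmc.trans (hfb ⟨h', hx.2⟩ : f c < f x).le
  · exact hmin ⟨h, h'⟩

theorem StrictConvexOn.lt_of_isMinOn_of_mem_openSegment {f : ℝ → ℝ} {s : Set ℝ} {m x y : ℝ}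
    (hf : StrictConvexOn ℝ s f) (hm : m ∈ s) (hmin : IsMinOn f s m) (hx : x ∈ s) (hxm : x ≠ m)
    (hy : y ∈ openSegment ℝ x m) : f y < f x := by
  have h := hf.lt_on_openSegment hx hm hxm hy
  rwa [max_eq_left (isMinOn_iff.1 hmin x hx)] at h

theorem StrictConvexOn.lt_of_isMinOn {f : ℝ → ℝ} {s : Set ℝ} {m x : ℝ}
    (hf : StrictConvexOn ℝ s f) (hm : m ∈ s) (hmin : IsMinOn f s m) (hx : x ∈ s)
    (hxm : x ≠ m) : f m < f x := by
  have hmid := midpoint_mem_openSegment (𝕜 := ℝ) x m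
  exact (isMinOn_iff.1 hmin _ (hf.1.openSegment_subset hx hm hmid)).trans_lt
    (hf.lt_of_isMinOn_of_mem_openSegment hm hmin hx hxm hmid)

theorem StrictConvexOn.strictAntiOn_Ioc_of_isMinOn {f : ℝ → ℝ} {a b m : ℝ}
    (hf : StrictConvexOn ℝ (Ioo a b) f) (hm : m ∈ Ioo a b) (hmin : IsMinOn f (Ioo a b) m) :
    StrictAntiOn f (Ioc a m) := by
  intro x hx y hy hxy
  have hxm : x < m := hxy.trans_le hy.2
  have hx' : x ∈ Ioo a b := ⟨hx.1, hxm.trans hm.2⟩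
  rcases hy.2.eq_or_lt with rfl | hym
  · exact hf.lt_of_isMinOn hm hmin hx' hxm.ne
  · refine hf.lt_of_isMinOn_of_mem_openSegment hm hmin hx' hxm.ne ?_
    rw [openSegment_eq_Ioo hxm]
    exact ⟨hxy, hym⟩

theorem StrictConvexOn.strictMonoOn_Ico_of_isMinOn {f : ℝ → ℝ} {a b m : ℝ}
    (hf : StrictConvexOn ℝ (Ioo a b) f) (hm : m ∈ Ioo a b) (hmin : IsMinOn f (Ioo a b) m) :
    StrictMonoOn f (Ico m b) := by
  intro x hx y hy hxy
  have hmy : m < y := hx.1.trans_lt hxy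
  have hy' : y ∈ Ioo a b := ⟨hm.1.trans hmy, hy.2⟩
  rcases hx.1.eq_or_lt with rfl | hmx
  · exact hf.lt_of_isMinOn hm hmin hy' hmy.ne'
  · refine hf.lt_of_isMinOn_of_mem_openSegment hm hmin hy' hmy.ne' ?_
    rw [openSegment_symm, openSegment_eq_Ioo hmy]
    exact ⟨hmx, hxy⟩

theorem not_lt_of_strictMonoOn_Ioc_of_strictAntiOn_Ico {f : ℝ → ℝ} {a b m n : ℝ}
    (hm : m ∈ Ioo a b) (hn : n ∈ Ioo a b) (hmono : StrictMonoOn f (Ioc a n))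
    (hanti : StrictAntiOn f (Ico m b)) : ¬ m < n := fun h =>
  lt_asymm (hmono ⟨hm.1, h.le⟩ ⟨hn.1, le_rfl⟩ h) (hanti ⟨le_rfl, hm.2⟩ ⟨h.le, hn.2⟩ h)

/-- A positive strictly convex function blowing up at both ends of an interval has a unimodal
reciprocal. -/
theorem StrictConvexOn.existsUnique_unimodal_inv {f : ℝ → ℝ} {a b : ℝ} (hab : a < b)
    (hf : StrictConvexOn ℝ (Ioo a b) f) (hpos : ∀ x ∈ Ioo a b, 0 < f x)
    (ha : Tendsto f (𝓝[>] a) atTop) (hb : Tendsto f (𝓝[<] b) atTop) :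
    ∃! m : ℝ, m ∈ Ioo a b ∧ StrictMonoOn (fun x => (f x)⁻¹) (Ioc a m) ∧
      StrictAntiOn (fun x => (f x)⁻¹) (Ico m b) := by
  obtain ⟨m, hm, hmin⟩ := exists_isMinOn_Ioo_of_tendsto_atTop hab
    (hf.convexOn.continuousOn isOpen_Ioo) ha hb
  have hmono_m : StrictMonoOn (fun x => (f x)⁻¹) (Ioc a m) := fun x hx y hy hxy =>
    inv_strictAnti₀ (hpos y ⟨hy.1, hy.2.trans_lt hm.2⟩)
      (hf.strictAntiOn_Ioc_of_isMinOn hm hmin hx hy hxy)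
  have hanti_m : StrictAntiOn (fun x => (f x)⁻¹) (Ico m b) := fun x hx y hy hxy =>
    inv_strictAnti₀ (hpos x ⟨hm.1.trans_le hx.1, hx.2⟩)
      (hf.strictMonoOn_Ico_of_isMinOn hm hmin hx hy hxy)
  refine ⟨m, ⟨hm, hmono_m, hanti_m⟩, ?_⟩
  rintro n ⟨hn, hmono, hanti⟩
  exact le_antisymm
    (not_lt.1 (not_lt_of_strictMonoOn_Ioc_of_strictAntiOn_Ico hm hn hmono hanti_m))
    (not_lt.1 (not_lt_of_strictMonoOn_Ioc_of_strictAntiOn_Ico hn hm hmono_m hanti))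

/-- Partial fractions of the reciprocal speed, with the negative residues at `α` and `α ^ 2`
absorbed into products with the pole at `1`. -/
theorem reciprocal_speed_eq {α β : ℝ} (h0 : 0 < α) (h1 : α < 1) (hβ : 1 < β)
    (hαβ : 0 < 1 - α * β) :
    (β + 1) / (β - 1) + ((1 - α) / (1 + α)) *
        ((β + 3) / (2 * (β - 1))
          + (β * (β + 1) / (β - 1) ^ 2) *
              ((1 - α) / (1 - α * β) - (1 - α) / (1 - α / β))
          + (2 * β / (β - 1) - (β - α) / (β - α ^ 2)) * ((1 - α) / (1 - α / β))) =
      (1 - α * β)⁻¹ + (6 + 2 * α - α ^ 2 * (4 - 3 * α + α ^ 2)) / (1 + α) * (β - 1)⁻¹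
        + α ^ 2 * (3 - α) * (1 - α) / (1 + α) * ((β - 1)⁻¹ * (β - α)⁻¹)
        + α ^ 2 * (1 - α) ^ 3 * ((β - 1)⁻¹ * (β - α ^ 2)⁻¹)
        + (1 + (1 - α) / (1 + α) / 2) := by
  have e1 : β - 1 ≠ 0 := (sub_pos.2 hβ).ne'
  have e2 : β - α ≠ 0 := by linarith
  have e3 : β - α ^ 2 ≠ 0 := by nlinarith
  have e4 : 1 + α ≠ 0 := by linarith
  have e5 : 1 - β * α ≠ 0 := by rw [mul_comm]; exact hαβ.ne'
  have e6 : β ≠ 0 := by linarith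
  have hs : (1 - α) / (1 - α / β) = (1 - α) * β / (β - α) := by
    have : 1 - α / β = (β - α) / β := by field_simp
    rw [this, div_div_eq_mul_div]
  rw [hs]
  field_simp
  ring

/-- For fixed `α ∈ (0,1)`, the reciprocal speed
`g(β) = 1/v(β)` is strictly convex on `(1, 1/α)`, tends to `+∞` at both endpoints,
and hence `v = 1/g` is unimodal: there is a unique `β_max ∈ (1, 1/α)` such that `v` is
strictly increasing on `(1, β_max]` and strictly decreasing on `[β_max, 1/α)`. -/
theorem reciprocal_speed_strictly_convex_and_speed_unimodal
    (α : ℝ) (hα : α ∈ Set.Ioo (0 : ℝ) 1) :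
    let g : ℝ → ℝ := fun β =>
      (β + 1) / (β - 1) + ((1 - α) / (1 + α)) *
        ((β + 3) / (2 * (β - 1))
          + (β * (β + 1) / (β - 1) ^ 2) *
              ((1 - α) / (1 - α * β) - (1 - α) / (1 - α / β))
          + (2 * β / (β - 1) - (β - α) / (β - α ^ 2)) * ((1 - α) / (1 - α / β)))
    StrictConvexOn ℝ (Set.Ioo (1 : ℝ) (1 / α)) g ∧
    Tendsto g (𝓝[>] (1 : ℝ)) atTop ∧
    Tendsto g (𝓝[<] (1 / α)) atTop ∧
    ∃! βmax : ℝ, βmax ∈ Set.Ioo (1 : ℝ) (1 / α) ∧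
      StrictMonoOn (fun β => (g β)⁻¹) (Set.Ioc (1 : ℝ) βmax) ∧
      StrictAntiOn (fun β => (g β)⁻¹) (Set.Ico βmax (1 / α)) := by
  intro g
  obtain ⟨h0, h1⟩ := hα
  have hlt : (1 : ℝ) < 1 / α := by rwa [lt_div_iff₀ h0, one_mul]
  set P : ℝ := (6 + 2 * α - α ^ 2 * (4 - 3 * α + α ^ 2)) / (1 + α) with hP
  set D : ℝ := α ^ 2 * (3 - α) * (1 - α) / (1 + α) with hD
  set E : ℝ := α ^ 2 * (1 - α) ^ 3 with hE
  set K : ℝ := 1 + (1 - α) / (1 + α) / 2 with hK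
  have h1' : 0 < 1 - α := sub_pos.2 h1
  have hPpos : 0 < P := by
    refine div_pos ?_ (by linarith)
    nlinarith [mul_pos h0 h1', mul_pos (mul_pos h0 h0) h1', sq_nonneg (α * (1 - α)),
      pow_pos h0 3]
  have hDpos : 0 < D := by
    have : 0 < 3 - α := by linarith
    positivity
  have hEpos : 0 < E := by positivity
  have hKpos : 0 < K := by positivity
  have hden : ∀ x ∈ Ioo (1 : ℝ) (1 / α), 0 < 1 - α * x := fun x hx => by
    have := (lt_div_iff₀ h0).1 hx.2
    linarith
  have hgeq : ∀ x ∈ Ioo (1 : ℝ) (1 / α), (1 - α * x)⁻¹ + P * (x - 1)⁻¹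
      + D * ((x - 1)⁻¹ * (x - α)⁻¹) + E * ((x - 1)⁻¹ * (x - α ^ 2)⁻¹) + K = g x :=
    fun x hx => (reciprocal_speed_eq h0 h1 hx.1 (hden x hx)).symm
  have hα2 : α ^ 2 < 1 := by nlinarith
  have hone : ∀ x ∈ Ioo (1 : ℝ) (1 / α), (1 : ℝ) < x := fun x hx => hx.1
  have hgta : ∀ x ∈ Ioo (1 : ℝ) (1 / α), α < x := fun x hx => h1.trans hx.1
  have hgta2 : ∀ x ∈ Ioo (1 : ℝ) (1 / α), α ^ 2 < x := fun x hx => hα2.trans hx.1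
  have hconv : Convex ℝ (Ioo (1 : ℝ) (1 / α)) := convex_Ioo _ _
  have hstrict : StrictConvexOn ℝ (Ioo (1 : ℝ) (1 / α)) g := by
    have hA : StrictConvexOn ℝ (Ioo (1 : ℝ) (1 / α)) fun x => (1 - α * x)⁻¹ := by
      have h := strictConvexOn_inv_affine (p := -α) (q := 1) (neg_ne_zero.2 h0.ne') hconv
        fun x hx => by linarith [hden x hx]
      refine h.congr fun x _ => ?_
      simp only
      congr 1
      ring
    exact ((((hA.add_convexOn ((convexOn_inv_sub hconv hone).smul hPpos.le)).add_convexOn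
      ((convexOn_inv_sub_mul_inv_sub hconv hone hgta).smul hDpos.le)).add_convexOn
      ((convexOn_inv_sub_mul_inv_sub hconv hone hgta2).smul hEpos.le)).add_const K).congr hgeq
  have hge : ∀ x ∈ Ioo (1 : ℝ) (1 / α),
      P * (x - 1)⁻¹ ≤ g x ∧ (1 - α * x)⁻¹ ≤ g x ∧ 0 < g x := fun x hx => by
    rw [← hgeq x hx]
    have i1 : 0 < (1 - α * x)⁻¹ := inv_pos.2 (hden x hx)
    have i2 : 0 < (x - 1)⁻¹ := inv_pos.2 (sub_pos.2 hx.1)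
    have i3 : 0 < (x - α)⁻¹ := inv_pos.2 (sub_pos.2 (hgta x hx))
    have i4 : 0 < (x - α ^ 2)⁻¹ := inv_pos.2 (sub_pos.2 (hgta2 x hx))
    have j2 := mul_pos hPpos i2
    have j3 := mul_pos hDpos (mul_pos i2 i3)
    have j4 := mul_pos hEpos (mul_pos i2 i4)
    refine ⟨?_, ?_, ?_⟩ <;> linarith
  have hleft : Tendsto g (𝓝[>] (1 : ℝ)) atTop := by
    refine tendsto_atTop_mono' _ ?_ ((tendsto_inv_sub_nhdsGT 1).const_mul_atTop hPpos)
    filter_upwards [Ioo_mem_nhdsGT hlt] with x hx using (hge x hx).1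
  have hright : Tendsto g (𝓝[<] (1 / α)) atTop := by
    refine tendsto_atTop_mono' _ ?_ (tendsto_inv_one_sub_mul_nhdsLT h0)
    filter_upwards [Ioo_mem_nhdsLT hlt] with x hx using (hge x hx).2.1
  exact ⟨hstrict, hleft, hright,
    hstrict.existsUnique_unimodal_inv hlt (fun x hx => (hge x hx).2.2) hleft hright⟩
end

section
/- For every α ∈ (0,1) and every β ∈ (1, 1/α) one has s_+ − s_− > 0 and C > 0; consequently the speed satisfies 0 < v(β) < (β−1)/(β+1), i.e. it is strictly smaller than the speed (β−1)/(β+1) of the β-biased random walk on ℤ. -/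
open Set

/-- For every `α ∈ (0,1)` and `β ∈ (1, 1/α)` one has `s₊ - s₋ > 0` and
`C > 0`; consequently the speed `v(β) = 1/g(β)` satisfies `0 < v(β) < (β-1)/(β+1)`,
i.e. it is strictly smaller than the speed of the `β`-biased random walk on `ℤ`. -/
theorem speed_positive_and_slower_than_biased_walk_on_Z
    (α β : ℝ) (hα : α ∈ Set.Ioo (0 : ℝ) 1) (hβ : β ∈ Set.Ioo (1 : ℝ) (1 / α)) :
    let sp : ℝ := (1 - α) / (1 - α * β)
    let sm : ℝ := (1 - α) / (1 - α / β)
    let C : ℝ := 2 * β / (β - 1) - (β - α) / (β - α ^ 2)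
    let g : ℝ := (β + 1) / (β - 1) + ((1 - α) / (1 + α)) *
      ((β + 3) / (2 * (β - 1)) + (β * (β + 1) / (β - 1) ^ 2) * (sp - sm) + C * sm)
    0 < sp - sm ∧ 0 < C ∧ 0 < g⁻¹ ∧ g⁻¹ < (β - 1) / (β + 1) := by
  obtain ⟨hα0, hα1⟩ := hα
  obtain ⟨hβ1, hβα⟩ := hβ
  intro sp sm C g
  have hβ0 : 0 < β := by linarith
  have hβm : 0 < β - 1 := by linarith
  have hαm : 0 < 1 - α := by linarith
  have hαβ : 0 < 1 - α * β := by
    rw [lt_div_iff₀ hα0] at hβα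
    linarith
  have hlt : 1 - α * β < 1 - α / β := by
    have h₁ : α / β < α := div_lt_self hα0 hβ1
    have h₂ : α < α * β := lt_mul_of_one_lt_right hα0 hβ1
    linarith
  have hs : 0 < sp - sm := sub_pos.2 (div_lt_div_of_pos_left hαm hαβ hlt)
  have hsm : 0 < sm := div_pos hαm (hαβ.trans hlt)
  have hC : 0 < C := by
    have hsq : α ^ 2 < α := by nlinarith
    have h₁ : (β - α) / (β - α ^ 2) < 1 := by
      rw [div_lt_one (by linarith)]
      linarith
    have h₂ : 1 < 2 * β / (β - 1) := by
      rw [one_lt_div hβm]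
      linarith
    exact sub_pos.2 (h₁.trans h₂)
  have hpos : 0 < (β + 1) / (β - 1) := by positivity
  have hg : (β + 1) / (β - 1) < g := lt_add_of_pos_right _ (by positivity)
  refine ⟨hs, hC, inv_pos.2 (hpos.trans hg), ?_⟩
  rw [← inv_div (β + 1) (β - 1)]
  exact inv_strictAnti₀ hpos hg
end

section
/- For every fixed β > 1, the partial derivative of the speed with respect to α satisfies lim_{α↓0} ∂v(α,β)/∂α = 4(β−1)(β+1)(3−β)/(5β+7)². In particular this limit is strictly positive if β < 3 and strictly negative if β > 3. -/
open Filter Topology Set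

/-- The reciprocal of the speed has derivative `(β - 3) * (β + 1) / (β - 1)` in `a` at `a = 0`. -/
theorem hasDerivAt_inv_speed_zero {β : ℝ} (hβ : 1 < β) :
    HasDerivAt (fun a : ℝ =>
        (β + 1) / (β - 1) + ((1 - a) / (1 + a)) *
          ((β + 3) / (2 * (β - 1))
            + (β * (β + 1) / (β - 1) ^ 2) *
                ((1 - a) / (1 - a * β) - (1 - a) / (1 - a / β))
            + (2 * β / (β - 1) - (β - a) / (β - a ^ 2)) * ((1 - a) / (1 - a / β))))
      ((β - 3) * (β + 1) / (β - 1)) 0 := by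
  have h0 : β ≠ 0 := by linarith
  have h1 : β - 1 ≠ 0 := by linarith
  have hid := hasDerivAt_id' (0 : ℝ)
  have hnum := hid.const_sub 1
  have hratio := hnum.fun_div (hid.const_add 1) (by norm_num)
  have hsplus := hnum.fun_div ((hid.mul_const β).const_sub 1) (by norm_num)
  have hsminus := hnum.fun_div ((hid.div_const β).const_sub 1) (by norm_num)
  have hC := ((hid.const_sub β).fun_div ((hid.fun_pow 2).const_sub β)
    (by simpa using h0)).const_sub (2 * β / (β - 1))
  refine ((hratio.fun_mul ((((hsplus.fun_sub hsminus).const_mul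
    (β * (β + 1) / (β - 1) ^ 2)).const_add ((β + 3) / (2 * (β - 1)))).fun_add
      (hC.fun_mul hsminus))).const_add ((β + 1) / (β - 1))).congr_deriv ?_
  simp
  field_simp
  ring

/-- For every fixed `β > 1`, the partial derivative of the speed
`v(α,β) = (g(α,β))⁻¹` with respect to `α` satisfies
`lim_{α↓0} ∂v/∂α = 4(β-1)(β+1)(3-β)/(5β+7)²`; in particular this limit is strictly
positive if `β < 3` and strictly negative if `β > 3`. -/
theorem deriv_speed_in_alpha_limit_at_zero (β : ℝ) (hβ : 1 < β) :
    Tendsto (fun α : ℝ => deriv (fun a : ℝ =>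
        ((β + 1) / (β - 1) + ((1 - a) / (1 + a)) *
          ((β + 3) / (2 * (β - 1))
            + (β * (β + 1) / (β - 1) ^ 2) *
                ((1 - a) / (1 - a * β) - (1 - a) / (1 - a / β))
            + (2 * β / (β - 1) - (β - a) / (β - a ^ 2)) * ((1 - a) / (1 - a / β))))⁻¹) α)
      (𝓝[>] (0 : ℝ)) (𝓝 (4 * (β - 1) * (β + 1) * (3 - β) / (5 * β + 7) ^ 2)) ∧
    (β < 3 → 0 < 4 * (β - 1) * (β + 1) * (3 - β) / (5 * β + 7) ^ 2) ∧
    (3 < β → 4 * (β - 1) * (β + 1) * (3 - β) / (5 * β + 7) ^ 2 < 0) := by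
  have h0 : β ≠ 0 := by linarith
  have h1 : 0 < β - 1 := by linarith
  have h7 : 0 < 5 * β + 7 := by linarith
  refine ⟨?_, fun h => ?_, fun h => ?_⟩
  · have hval : (β + 1) / (β - 1) + ((1 - (0 : ℝ)) / (1 + 0)) *
          ((β + 3) / (2 * (β - 1))
            + (β * (β + 1) / (β - 1) ^ 2) *
                ((1 - 0) / (1 - 0 * β) - (1 - 0) / (1 - 0 / β))
            + (2 * β / (β - 1) - (β - 0) / (β - 0 ^ 2)) * ((1 - 0) / (1 - 0 / β)))
          = (5 * β + 7) / (2 * (β - 1)) := by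
      simp
      field_simp
      ring
    have hne : (5 * β + 7) / (2 * (β - 1)) ≠ 0 := by positivity
    have hd := (hasDerivAt_inv_speed_zero hβ).fun_inv (by rw [hval]; exact hne)
    have han : AnalyticAt ℝ (fun a : ℝ =>
        ((β + 1) / (β - 1) + ((1 - a) / (1 + a)) *
          ((β + 3) / (2 * (β - 1))
            + (β * (β + 1) / (β - 1) ^ 2) *
                ((1 - a) / (1 - a * β) - (1 - a) / (1 - a / β))
            + (2 * β / (β - 1) - (β - a) / (β - a ^ 2)) * ((1 - a) / (1 - a / β))))⁻¹) 0 := by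
      refine AnalyticAt.fun_inv ?_ (by rw [hval]; exact hne)
      fun_prop (disch := simp [h0])
    have hlim := han.deriv.continuousAt.tendsto.mono_left
      (nhdsWithin_le_nhds (s := Ioi (0 : ℝ)))
    rw [hd.deriv, hval] at hlim
    convert hlim using 2
    field_simp
    ring
  · have : 0 < 3 - β := by linarith
    positivity
  · apply div_neg_of_neg_of_pos _ (by positivity)
    exact mul_neg_of_pos_of_neg (by positivity) (by linarith)
end

section
/- For every fixed α ∈ (0,1), the speed v(β) (extended by v(1) := 0) is differentiable from the right at β = 1 and 2·(∂v/∂β)|_{β=1} = (1+α)/(3+α); equivalently, lim_{β↓1} v(β)/(β−1) = (1+α)/(2(3+α)). (This identity expresses the Einstein relation: the right-hand side 2·(∂v/∂β)|_{β=1} equals the diffusivity σ² = (1+α)/(3+α) of the unbiased walk.) -/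
open Filter Topology Set

/-- The reciprocal speed multiplied by `β - 1`, with the singularity at `β = 1` removed. -/
noncomputable def scaledInvSpeed (α β : ℝ) : ℝ :=
  (β + 1) + ((1 - α) / (1 + α)) *
    ((β + 3) / 2
      + (β + 1) ^ 2 * α * ((1 - α) / ((1 - α * β) * (1 - α / β)))
      + (2 * β - (β - 1) * ((β - α) / (β - α ^ 2))) * ((1 - α) / (1 - α / β)))

lemma scaledInvSpeed_one {α : ℝ} (hα : α ∈ Set.Ioo (0 : ℝ) 1) :
    scaledInvSpeed α 1 = 2 * (3 + α) / (1 + α) := by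
  have h1 : 1 - α ≠ 0 := by linarith [hα.2]
  have h2 : 1 + α ≠ 0 := by linarith [hα.1]
  simp only [scaledInvSpeed, mul_one, div_one]
  field_simp
  ring

lemma continuousAt_scaledInvSpeed {α : ℝ} (hα : α ∈ Set.Ioo (0 : ℝ) 1) :
    ContinuousAt (scaledInvSpeed α) 1 := by
  obtain ⟨h0, h1⟩ := hα
  have ha : 1 - α ≠ 0 := by linarith
  have hb : 1 - α ^ 2 ≠ 0 := by nlinarith
  unfold scaledInvSpeed
  fun_prop (disch := simp [ha])

lemma inv_speed_eq_scaledInvSpeed_div {α β : ℝ} (hβ : β - 1 ≠ 0) (hβ₀ : β ≠ 0)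
    (hp : 1 - α * β ≠ 0) (hm : β - α ≠ 0) :
    (β + 1) / (β - 1) + ((1 - α) / (1 + α)) *
        ((β + 3) / (2 * (β - 1))
          + (β * (β + 1) / (β - 1) ^ 2) *
              ((1 - α) / (1 - α * β) - (1 - α) / (1 - α / β))
          + (2 * β / (β - 1) - (β - α) / (β - α ^ 2)) * ((1 - α) / (1 - α / β)))
      = scaledInvSpeed α β / (β - 1) := by
  have hm' : 1 - α / β ≠ 0 := by
    rw [one_sub_div hβ₀]
    exact div_ne_zero hm hβ₀
  have hdiff : (β * (β + 1) / (β - 1) ^ 2) *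
      ((1 - α) / (1 - α * β) - (1 - α) / (1 - α / β))
      = (β + 1) ^ 2 * α * ((1 - α) / ((1 - α * β) * (1 - α / β))) / (β - 1) := by
    rw [div_sub_div _ _ hp hm']
    have hnum : (1 - α) * (1 - α / β) - (1 - α * β) * (1 - α)
        = (1 - α) * α * ((β - 1) * (β + 1)) / β := by
      field_simp
      ring
    rw [hnum]
    generalize (1 - α * β) * (1 - α / β) = D
    field_simp
  have hC : 2 * β / (β - 1) - (β - α) / (β - α ^ 2)
      = (2 * β - (β - 1) * ((β - α) / (β - α ^ 2))) / (β - 1) := by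
    rw [sub_div (2 * β), mul_div_cancel_left₀ _ hβ]
  rw [hdiff, hC, div_mul_eq_div_div, scaledInvSpeed]
  ring

/-- For every fixed `α ∈ (0,1)`, the speed `v` (extended by `v(1) := 0`)
is differentiable from the right at `β = 1`, with `2·(∂v/∂β)|_{β=1} = (1+α)/(3+α)`;
equivalently `lim_{β↓1} v(β)/(β-1) = (1+α)/(2(3+α))`.  This is the Einstein relation:
`2·(∂v/∂β)|_{β=1}` equals the diffusivity `σ² = (1+α)/(3+α)` of the unbiased walk. -/
theorem einstein_relation_right_derivative_of_speed
    (α : ℝ) (hα : α ∈ Set.Ioo (0 : ℝ) 1) :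
    let v : ℝ → ℝ := fun β => if β = 1 then 0 else
      ((β + 1) / (β - 1) + ((1 - α) / (1 + α)) *
        ((β + 3) / (2 * (β - 1))
          + (β * (β + 1) / (β - 1) ^ 2) *
              ((1 - α) / (1 - α * β) - (1 - α) / (1 - α / β))
          + (2 * β / (β - 1) - (β - α) / (β - α ^ 2)) * ((1 - α) / (1 - α / β))))⁻¹
    ∃ d : ℝ, HasDerivWithinAt v d (Set.Ici (1 : ℝ)) 1 ∧
      2 * d = (1 + α) / (3 + α) ∧
      Tendsto (fun β : ℝ => v β / (β - 1)) (𝓝[>] (1 : ℝ))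
        (𝓝 ((1 + α) / (2 * (3 + α)))) := by
  intro v
  have hg := continuousAt_scaledInvSpeed hα
  have hg1 := scaledInvSpeed_one hα
  obtain ⟨h0, h1⟩ := hα
  have hpos : 0 < 2 * (3 + α) / (1 + α) := by positivity
  have hlim : Tendsto (fun β : ℝ => (scaledInvSpeed α β)⁻¹) (𝓝[>] (1 : ℝ))
      (𝓝 ((1 + α) / (2 * (3 + α)))) := by
    rw [← inv_div, ← hg1]
    exact (hg.inv₀ (hg1 ▸ hpos.ne')).tendsto.mono_left nhdsWithin_le_nhds
  have hp : ∀ᶠ β in 𝓝[>] (1 : ℝ), 1 - α * β ≠ 0 := by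
    have hc : ContinuousAt (fun β : ℝ => 1 - α * β) 1 := by fun_prop
    exact (hc.eventually_ne (by linarith)).filter_mono nhdsWithin_le_nhds
  have hv : Tendsto (fun β : ℝ => v β / (β - 1)) (𝓝[>] (1 : ℝ))
      (𝓝 ((1 + α) / (2 * (3 + α)))) := by
    refine hlim.congr' ?_
    filter_upwards [hp, self_mem_nhdsWithin] with β hpβ hβ
    have hβ1 : 1 < β := hβ
    have hne : β - 1 ≠ 0 := by linarith
    simp only [v]
    rw [if_neg hβ1.ne', inv_speed_eq_scaledInvSpeed_div hne (by linarith) hpβ (by linarith),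
      inv_div, div_div_cancel_left' hne]
  refine ⟨(1 + α) / (2 * (3 + α)), ?_, by field_simp, hv⟩
  rw [hasDerivWithinAt_iff_tendsto_slope, Set.Ici_sdiff_left]
  refine hv.congr fun β => ?_
  simp [slope_def_field, v]
end

section
/- For every α ∈ (0,1), the derivative of the speed at the second critical point β_c^{(2)} := 1/√α is strictly positive: (∂v/∂β)|_{β=1/√α} > 0. Consequently β_c^{(2)} is strictly smaller than the value β_max ∈ (1, 1/α) at which β ↦ v(β) attains its maximum. -/
open Filter Topology Set

/-- The reciprocal speed for `α = t ^ 2`, in the variable `s = 1 / β`. -/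
noncomputable def slowness (t s : ℝ) : ℝ :=
  (1 + s) / (1 - s) + (1 - t ^ 2) / (1 + t ^ 2) *
    ((1 + 3 * s) / (2 * (1 - s))
      + t ^ 2 * (1 - t ^ 2) * ((1 + s) ^ 2 / ((1 - s) * (s - t ^ 2) * (1 - t ^ 2 * s)))
      + (1 - t ^ 2) * (2 / ((1 - s) * (1 - t ^ 2 * s)) - 1 / (1 - t ^ 4 * s)))

/-- The numerator of the difference quotient between `s` and `t` of
`s ↦ (1 + s) ^ 2 / ((1 - s) * (s - t ^ 2) * (1 - t ^ 2 * s))`. -/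
def slopeNumerator (t s : ℝ) : ℝ :=
  -1 + t - 3 * t ^ 2 - 2 * t ^ 4 + t ^ 5 + s + 3 * s * t + 2 * s * t ^ 3 - s * t ^ 4
    + 3 * s * t ^ 5 - s ^ 2 * t ^ 2 - 2 * s ^ 2 * t ^ 3 - s ^ 2 * t ^ 4

/-- The difference quotient of `slowness t` between `s` and `t`, extended to `s = t`. -/
noncomputable def slownessSlope (t s : ℝ) : ℝ :=
  4 / ((1 + t ^ 2) * (1 - s) * (1 - t)) + (1 - t ^ 2) / (1 + t ^ 2) *
    (t ^ 2 * (1 - t ^ 2) * (slopeNumerator t s /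
        (((1 - s) * (s - t ^ 2) * (1 - t ^ 2 * s)) *
          ((1 - t) * (t - t ^ 2) * (1 - t ^ 2 * t))))
      + (1 - t ^ 2) * (2 * (1 + t ^ 2 - t ^ 2 * (s + t)) /
          ((1 - s) * (1 - t ^ 2 * s) * ((1 - t) * (1 - t ^ 2 * t)))
        - t ^ 4 / ((1 - t ^ 4 * s) * (1 - t ^ 4 * t))))

theorem slope_polynomial_pos {t s : ℝ} (ht : 0 < t) (hts : t ≤ s) (hs : s < 1) :
    0 < 4 * (s - t ^ 2) * (1 - t ^ 2 * s) * (t - t ^ 2) * (1 - t ^ 2 * t)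
      + t ^ 2 * (1 - t ^ 2) ^ 2 * slopeNumerator t s := by
  have hs0 : 0 < s := ht.trans_le hts
  obtain ⟨x, hx, rfl⟩ : ∃ x : ℝ, 0 < x ∧ s = 1 / (1 + x) :=
    ⟨1 / s - 1, by rw [sub_pos, lt_div_iff₀ hs0]; linarith, by simp⟩
  obtain ⟨y, hy, rfl⟩ : ∃ y : ℝ, 0 ≤ y ∧ t = 1 / ((1 + x) * (1 + y)) := by
    refine ⟨1 / (1 + x) / t - 1, ?_, ?_⟩
    · rw [sub_nonneg, le_div_iff₀ ht]; linarith
    · field_simp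
      ring
  have h : 0 < ((1 + x) * (1 + y)) ^ 13 * (4 * (1 / (1 + x) - (1 / ((1 + x) * (1 + y))) ^ 2)
      * (1 - (1 / ((1 + x) * (1 + y))) ^ 2 * (1 / (1 + x)))
      * (1 / ((1 + x) * (1 + y)) - (1 / ((1 + x) * (1 + y))) ^ 2)
      * (1 - (1 / ((1 + x) * (1 + y))) ^ 2 * (1 / ((1 + x) * (1 + y))))
      + (1 / ((1 + x) * (1 + y))) ^ 2 * (1 - (1 / ((1 + x) * (1 + y))) ^ 2) ^ 2
        * slopeNumerator (1 / ((1 + x) * (1 + y))) (1 / (1 + x))) := by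
    unfold slopeNumerator
    field_simp
    ring_nf
    positivity
  exact pos_of_mul_pos_right h (by positivity)

theorem slownessSlope_pos {t s : ℝ} (ht : 0 < t) (hts : t ≤ s) (hs : s < 1) :
    0 < slownessSlope t s := by
  have hs0 : 0 < s := ht.trans_le hts
  have ht1 : t < 1 := hts.trans_lt hs
  have ht2 : t ^ 2 < t := by nlinarith
  have h1 : 0 < 1 - s := by linarith
  have h2 : 0 < 1 - t := by linarith
  have h3 : 0 < s - t ^ 2 := by linarith
  have h4 : 0 < t - t ^ 2 := by linarith
  have h5 : 0 < 1 - t ^ 2 * s := by nlinarith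
  have h6 : 0 < 1 - t ^ 2 * t := by nlinarith
  have h7 : t ^ 4 ≤ t ^ 2 := by nlinarith
  have h8 : 0 < 1 - t ^ 2 := by linarith
  have hQ := slope_polynomial_pos ht hts hs
  have hmain : slownessSlope t s =
      (4 * (s - t ^ 2) * (1 - t ^ 2 * s) * (t - t ^ 2) * (1 - t ^ 2 * t)
        + t ^ 2 * (1 - t ^ 2) ^ 2 * slopeNumerator t s) /
        ((1 + t ^ 2) * ((1 - s) * (s - t ^ 2) * (1 - t ^ 2 * s)) *
          ((1 - t) * (t - t ^ 2) * (1 - t ^ 2 * t)))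
      + (1 - t ^ 2) ^ 2 / (1 + t ^ 2) * (2 * (1 + t ^ 2 - t ^ 2 * (s + t)) /
          ((1 - s) * (1 - t ^ 2 * s) * ((1 - t) * (1 - t ^ 2 * t)))
        - t ^ 4 / ((1 - t ^ 4 * s) * (1 - t ^ 4 * t))) := by
    unfold slownessSlope
    generalize t ^ 4 / ((1 - t ^ 4 * s) * (1 - t ^ 4 * t)) = z
    generalize slopeNumerator t s = e
    have h6' : 0 < 1 - t ^ 3 := by linarith
    rw [show t ^ 2 * t = t ^ 3 by ring] at *
    field_simp
    ring
  have h9 : 1 - t ^ 2 * s ≤ 1 - t ^ 4 * s := by nlinarith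
  have h10 : 1 - t ^ 2 * t ≤ 1 - t ^ 4 * t := by nlinarith
  have hlast : t ^ 4 / ((1 - t ^ 4 * s) * (1 - t ^ 4 * t)) ≤
      2 * (1 + t ^ 2 - t ^ 2 * (s + t)) /
          ((1 - s) * (1 - t ^ 2 * s) * ((1 - t) * (1 - t ^ 2 * t))) := by
    have hX : (1 - t ^ 2 * s) * (1 - t ^ 2 * t) ≤ (1 - t ^ 4 * s) * (1 - t ^ 4 * t) :=
      mul_le_mul h9 h10 h6.le (h5.le.trans h9)
    have hN : (1 - s) * (1 - t) ≤ 2 * (1 + t ^ 2 - t ^ 2 * (s + t)) := by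
      nlinarith [mul_pos hs0 h8, mul_pos (pow_pos ht 2) h2, mul_pos h1 ht]
    have hden : 0 < (1 - t ^ 4 * s) * (1 - t ^ 4 * t) := (mul_pos h5 h6).trans_le hX
    rw [div_le_div_iff₀ hden (by positivity)]
    calc t ^ 4 * ((1 - s) * (1 - t ^ 2 * s) * ((1 - t) * (1 - t ^ 2 * t)))
        ≤ 1 * ((1 - s) * (1 - t ^ 2 * s) * ((1 - t) * (1 - t ^ 2 * t))) :=
          mul_le_mul_of_nonneg_right (by linarith) (by positivity)
      _ = (1 - s) * (1 - t) * ((1 - t ^ 2 * s) * (1 - t ^ 2 * t)) := by ring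
      _ ≤ _ := mul_le_mul hN hX (by positivity) ((by positivity : (0 : ℝ) ≤ _).trans hN)
  rw [hmain]
  have : 0 ≤ (1 - t ^ 2) ^ 2 / (1 + t ^ 2) * (2 * (1 + t ^ 2 - t ^ 2 * (s + t)) /
          ((1 - s) * (1 - t ^ 2 * s) * ((1 - t) * (1 - t ^ 2 * t)))
        - t ^ 4 / ((1 - t ^ 4 * s) * (1 - t ^ 4 * t))) :=
    mul_nonneg (by positivity) (sub_nonneg.2 hlast)
  positivity

theorem slowness_sub_slowness {t s : ℝ} (ht : 0 < t) (ht1 : t < 1) (hs : t ^ 2 < s)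
    (hs1 : s < 1) : slowness t s - slowness t t = (s - t) * slownessSlope t s := by
  have hs0 : 0 < s := (by positivity : 0 < t ^ 2).trans hs
  have ht2 : t ^ 2 < t := by nlinarith
  have ht4 : t ^ 4 < t ^ 2 := by nlinarith
  have h1 : 1 - s ≠ 0 := by linarith
  have h2 : 1 - t ≠ 0 := by linarith
  have h3 : s - t ^ 2 ≠ 0 := by linarith
  have h4 : t - t ^ 2 ≠ 0 := by linarith
  have h5 : 1 - t ^ 2 * s ≠ 0 := by nlinarith
  have h6 : 1 - t ^ 2 * t ≠ 0 := by nlinarith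
  have h7 : 1 - t ^ 4 * s ≠ 0 := by nlinarith
  have h8 : 1 - t ^ 4 * t ≠ 0 := by nlinarith
  have e1 : (1 + s) / (1 - s) - (1 + t) / (1 - t) = (s - t) * (2 / ((1 - s) * (1 - t))) := by
    field_simp; ring
  have e2 : (1 + 3 * s) / (2 * (1 - s)) - (1 + 3 * t) / (2 * (1 - t)) =
      (s - t) * (2 / ((1 - s) * (1 - t))) := by
    field_simp; ring
  have e3 : (1 + s) ^ 2 / ((1 - s) * (s - t ^ 2) * (1 - t ^ 2 * s))
      - (1 + t) ^ 2 / ((1 - t) * (t - t ^ 2) * (1 - t ^ 2 * t)) =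
      (s - t) * (slopeNumerator t s / (((1 - s) * (s - t ^ 2) * (1 - t ^ 2 * s)) *
          ((1 - t) * (t - t ^ 2) * (1 - t ^ 2 * t)))) := by
    rw [div_sub_div _ _ (by positivity) (by positivity), mul_div_assoc']
    unfold slopeNumerator
    congr 1
    ring
  have e4 : 2 / ((1 - s) * (1 - t ^ 2 * s)) - 2 / ((1 - t) * (1 - t ^ 2 * t)) =
      (s - t) * (2 * (1 + t ^ 2 - t ^ 2 * (s + t)) /
          ((1 - s) * (1 - t ^ 2 * s) * ((1 - t) * (1 - t ^ 2 * t)))) := by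
    rw [div_sub_div _ _ (by positivity) (by positivity), mul_div_assoc']
    congr 1
    ring
  have e5 : 1 / (1 - t ^ 4 * s) - 1 / (1 - t ^ 4 * t) =
      (s - t) * (t ^ 4 / ((1 - t ^ 4 * s) * (1 - t ^ 4 * t))) := by
    rw [div_sub_div _ _ (by positivity) (by positivity), mul_div_assoc']
    congr 1
    ring
  have e6 : 4 / ((1 + t ^ 2) * (1 - s) * (1 - t)) =
      (1 + (1 - t ^ 2) / (1 + t ^ 2)) * (2 / ((1 - s) * (1 - t))) := by
    field_simp; ring
  unfold slowness slownessSlope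
  rw [e6]
  linear_combination e1 + (1 - t ^ 2) / (1 + t ^ 2) *
    (e2 + t ^ 2 * (1 - t ^ 2) * e3 + (1 - t ^ 2) * (e4 - e5))

theorem slowness_self_pos {t : ℝ} (ht : 0 < t) (ht1 : t < 1) : 0 < slowness t t := by
  have ht2 : t ^ 2 < t := by nlinarith
  have h7 : t ^ 4 ≤ t ^ 2 := by nlinarith
  have h2 : 0 < 1 - t := by linarith
  have h4 : 0 < t - t ^ 2 := by linarith
  have h6 : 0 < 1 - t ^ 2 * t := by nlinarith
  have h8 : 0 < 1 - t ^ 2 := by linarith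
  have h : 1 / (1 - t ^ 4 * t) ≤ 2 / ((1 - t) * (1 - t ^ 2 * t)) :=
    div_le_div₀ (by norm_num) (by norm_num) (by positivity) (by nlinarith)
  have := sub_nonneg.2 h
  unfold slowness
  positivity

theorem hasDerivAt_slowness {t : ℝ} (ht : 0 < t) (ht1 : t < 1) :
    HasDerivAt (slowness t) (slownessSlope t t) t := by
  have ht2 : t ^ 2 < t := by nlinarith
  have ht4 : t ^ 4 < t ^ 2 := by nlinarith
  have hcont : ContinuousAt (slownessSlope t) t := by
    have h2 : 1 - t ≠ 0 := by linarith
    have h4 : t - t ^ 2 ≠ 0 := by linarith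
    have h6 : 1 - t ^ 2 * t ≠ 0 := by nlinarith
    have h8 : 1 - t ^ 4 * t ≠ 0 := by nlinarith
    unfold slownessSlope slopeNumerator
    fun_prop (disch := positivity)
  rw [hasDerivAt_iff_tendsto_slope]
  refine (hcont.tendsto.mono_left nhdsWithin_le_nhds).congr' ?_
  filter_upwards [self_mem_nhdsWithin, nhdsWithin_le_nhds (Ioo_mem_nhds ht2 ht1)] with s hs hs'
  rw [slope_def_field, slowness_sub_slowness ht ht1 hs'.1 hs'.2,
    mul_div_cancel_left₀ _ (sub_ne_zero.2 hs)]

theorem speed_denominator_eq_slowness {t β : ℝ} (ht : 0 < t) (ht1 : t < 1) (hβ : 1 < β)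
    (hβ' : β < 1 / t ^ 2) :
    (β + 1) / (β - 1) + ((1 - t ^ 2) / (1 + t ^ 2)) *
        ((β + 3) / (2 * (β - 1))
          + (β * (β + 1) / (β - 1) ^ 2) *
              ((1 - t ^ 2) / (1 - t ^ 2 * β) - (1 - t ^ 2) / (1 - t ^ 2 / β))
          + (2 * β / (β - 1) - (β - t ^ 2) / (β - (t ^ 2) ^ 2)) *
            ((1 - t ^ 2) / (1 - t ^ 2 / β))) = slowness t β⁻¹ := by
  have hβ0 : 0 < β := by linarith
  rw [lt_div_iff₀ (by positivity)] at hβ'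
  have ht2 : t ^ 2 < 1 := by nlinarith
  have ht4 : t ^ 4 < t ^ 2 := by nlinarith [pow_pos ht 2]
  have h1 : β - 1 ≠ 0 := by linarith
  have h2 : 1 - t ^ 2 * β ≠ 0 := by linarith
  have h3 : β - t ^ 2 ≠ 0 := by linarith
  have h4 : β - t ^ 4 ≠ 0 := by linarith
  have e1 : (1 + β⁻¹) / (1 - β⁻¹) = (β + 1) / (β - 1) := by
    rw [show 1 - β⁻¹ = (β - 1) / β by field_simp]; field_simp
  have e2 : (1 + 3 * β⁻¹) / (2 * (1 - β⁻¹)) = (β + 3) / (2 * (β - 1)) := by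
    rw [show 1 - β⁻¹ = (β - 1) / β by field_simp]; field_simp
  unfold slowness
  rw [e1, e2, show 1 - t ^ 2 / β = (β - t ^ 2) / β by field_simp,
    show 1 - β⁻¹ = (β - 1) / β by field_simp,
    show β⁻¹ - t ^ 2 = (1 - t ^ 2 * β) / β by field_simp,
    show 1 - t ^ 2 * β⁻¹ = (β - t ^ 2) / β by field_simp,
    show 1 - t ^ 4 * β⁻¹ = (β - t ^ 4) / β by field_simp,
    show (t ^ 2) ^ 2 = t ^ 4 by ring]
  field_simp
  ring

open Filter Topology Set

/-- For every `α ∈ (0,1)`, the derivative of the speed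
`v(β) = (g(β))⁻¹` at the second critical point `β_c⁽²⁾ = 1/√α` is strictly positive;
consequently `1/√α` is strictly smaller than any point `β_max ∈ (1, 1/α)` at which
`v` attains its maximum over `(1, 1/α)`. -/
theorem deriv_speed_positive_at_second_critical_point
    (α : ℝ) (hα : α ∈ Set.Ioo (0 : ℝ) 1) :
    let v : ℝ → ℝ := fun β =>
      ((β + 1) / (β - 1) + ((1 - α) / (1 + α)) *
        ((β + 3) / (2 * (β - 1))
          + (β * (β + 1) / (β - 1) ^ 2) *
              ((1 - α) / (1 - α * β) - (1 - α) / (1 - α / β))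
          + (2 * β / (β - 1) - (β - α) / (β - α ^ 2)) * ((1 - α) / (1 - α / β))))⁻¹
    0 < deriv v (1 / Real.sqrt α) ∧
    ∀ βmax ∈ Set.Ioo (1 : ℝ) (1 / α),
      (∀ β ∈ Set.Ioo (1 : ℝ) (1 / α), v β ≤ v βmax) → 1 / Real.sqrt α < βmax := by
  intro v
  obtain ⟨hα0, hα1⟩ := hα
  obtain ⟨t, ht, ht1, rfl⟩ : ∃ t : ℝ, 0 < t ∧ t < 1 ∧ α = t ^ 2 :=
    ⟨√α, Real.sqrt_pos.2 hα0, by rw [Real.sqrt_lt' one_pos]; simpa, (Real.sq_sqrt hα0.le).symm⟩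
  rw [Real.sqrt_sq ht.le]
  have hv : ∀ β ∈ Ioo (1 : ℝ) (1 / t ^ 2), v β = (slowness t β⁻¹)⁻¹ := fun β hβ =>
    congrArg _ (speed_denominator_eq_slowness ht ht1 hβ.1 hβ.2)
  have hmem : 1 / t ∈ Ioo (1 : ℝ) (1 / t ^ 2) :=
    ⟨one_lt_one_div ht ht1, one_div_lt_one_div_of_lt (by positivity) (by nlinarith)⟩
  have hnhds : Ioo (1 : ℝ) (1 / t ^ 2) ∈ 𝓝 (1 / t) := Ioo_mem_nhds hmem.1 hmem.2
  have hinv : (1 / t)⁻¹ = t := by simp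
  have hpos := slowness_self_pos ht ht1
  have hslope := slownessSlope_pos ht le_rfl ht1
  have hderiv : HasDerivAt v (slownessSlope t t * t ^ 2 / slowness t t ^ 2) (1 / t) := by
    have h := hasDerivAt_slowness ht ht1
    rw [← hinv] at h
    have hcomp := (h.comp (1 / t) (hasDerivAt_inv (by positivity))).inv
      (by simpa using hpos.ne')
    have hv_deriv := hcomp.congr_of_eventuallyEq (f₁ := v) (by
      filter_upwards [hnhds] with β hβ
      simpa using hv β hβ)
    refine hv_deriv.congr_deriv ?_
    simp
  have hderiv_pos : 0 < deriv v (1 / t) := by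
    rw [hderiv.deriv]
    positivity
  refine ⟨hderiv_pos, fun βmax hβ hmax => ?_⟩
  by_contra! hle
  have hβ0 : 0 < βmax := one_pos.trans hβ.1
  have hs : t ≤ βmax⁻¹ := by
    rw [← hinv]
    exact inv_anti₀ hβ0 hle
  have hs1 : βmax⁻¹ < 1 := inv_lt_one_of_one_lt₀ hβ.1
  have hdiff := slowness_sub_slowness ht ht1 (by nlinarith : t ^ 2 < βmax⁻¹) hs1
  have hmono : slowness t t ≤ slowness t βmax⁻¹ :=
    sub_nonneg.1 (hdiff ▸ mul_nonneg (sub_nonneg.2 hs) (slownessSlope_pos ht hs hs1).le)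
  have hv_le : v βmax ≤ v (1 / t) := by
    rw [hv _ hβ, hv _ hmem, hinv]
    exact inv_anti₀ hpos hmono
  have hloc : IsLocalMax v (1 / t) := by
    filter_upwards [hnhds] with β hβ'
    exact (hmax β hβ').trans hv_le
  exact hderiv_pos.ne' hloc.deriv_eq_zero
end

section
/- Trap of type (a): let β > 0 and k ≥ 1, and consider the finite graph with vertices x₁, y, x₂, t₁, …, t_k and edges {x₁,y}, {y,x₂} (conductances 1 and 1) and the path {y,t₁}, {t₁,t₂}, …, {t_{k−1},t_k} with conductances β, β², …, β^k. Let T_k be the number of steps the conductance-weighted random walk started at y takes strictly before its first visit to {x₁,x₂} (i.e. T_k = τ_{{x₁,x₂}} − 1 where τ is the first hitting time of {x₁,x₂}). Then E[T_k] = β(β^k − 1)/(β−1) if β ≠ 1, and E[T_k] = k if β = 1. -/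
open scoped BigOperators

/-- Conductances for a trap of type (a): vertices are `x₁ = Sum.inl 0`, `x₂ = Sum.inl 1`,
`y = Sum.inr 0` and the trap vertices `tⱼ = Sum.inr j` (`1 ≤ j ≤ k`).  The edges
`{x₁,y}` and `{y,x₂}` have conductance `1`, and the path `{y,t₁},…,{t_{k-1},t_k}` has
conductances `β, β², …, β^k`. -/
noncomputable def trapACond (β : ℝ) (k : ℕ) :
    (Fin 2 ⊕ Fin (k + 1)) → (Fin 2 ⊕ Fin (k + 1)) → ℝ
  | Sum.inl _, Sum.inr j => if (j : ℕ) = 0 then 1 else 0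
  | Sum.inr j, Sum.inl _ => if (j : ℕ) = 0 then 1 else 0
  | Sum.inr j, Sum.inr j' =>
      if (j : ℕ) + 1 = (j' : ℕ) ∨ (j' : ℕ) + 1 = (j : ℕ)
      then β ^ max (j : ℕ) (j' : ℕ) else 0
  | Sum.inl _, Sum.inl _ => 0

/-- The transition matrix of the conductance-weighted walk, killed upon hitting
`{x₁, x₂}`.  Thus `((trapAKilled β k) ^ n).mulVec 1 y = P_y[τ_{{x₁,x₂}} > n]`. -/
noncomputable def trapAKilled (β : ℝ) (k : ℕ) :
    Matrix (Fin 2 ⊕ Fin (k + 1)) (Fin 2 ⊕ Fin (k + 1)) ℝ := fun v w =>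
  if w = Sum.inl 0 ∨ w = Sum.inl 1 then 0
  else trapACond β k v w / ∑ u, trapACond β k v u

/-- The expected hitting time `E_y[τ_{{x₁,x₂}}] = Σ_{n≥0} P_y[τ > n]` of `{x₁,x₂}`
for the walk started at `y`. -/
noncomputable def trapAHit (β : ℝ) (k : ℕ) : ℝ :=
  ∑' n : ℕ, ((trapAKilled β k ^ n).mulVec (fun _ => (1 : ℝ))) (Sum.inr 0)

/-- If a nonnegative matrix `P` has a nonnegative solution `h` of `h = 1 + P h` (which forces
`1 ≤ h`), then `h` is the sum of the Neumann series `∑ P ^ n 1`. -/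
theorem Matrix.hasSum_pow_mulVec_one {ι : Type*} [Fintype ι] [DecidableEq ι]
    (P : Matrix ι ι ℝ) (hP : ∀ v w, 0 ≤ P v w) (h : ι → ℝ) (h0 : ∀ v, 0 ≤ h v)
    (hh : ∀ v, h v = 1 + P.mulVec h v) (v : ι) :
    HasSum (fun n : ℕ => ((P ^ n).mulVec (fun _ => (1 : ℝ))) v) (h v) := by
  have hPn : ∀ n : ℕ, ∀ v w, 0 ≤ (P ^ n) v w := by
    intro n
    induction n with
    | zero =>
      intro v w
      rw [pow_zero, Matrix.one_apply]
      split_ifs <;> norm_num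
    | succ n ih =>
      intro v w
      rw [pow_succ, Matrix.mul_apply]
      exact Finset.sum_nonneg fun i _ => mul_nonneg (ih v i) (hP i w)
  have hmul : ∀ (n : ℕ) (f : ι → ℝ), (∀ w, 0 ≤ f w) → 0 ≤ (P ^ n).mulVec f v := fun n f hf =>
    Finset.sum_nonneg fun i _ => mul_nonneg (hPn n v i) (hf i)
  have hstep : h = (fun _ => (1 : ℝ)) + P.mulVec h := funext hh
  have hpartial : ∀ N : ℕ, ∑ n ∈ Finset.range N, (P ^ n).mulVec (fun _ => (1 : ℝ)) v
      = h v - (P ^ N).mulVec h v := by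
    intro N
    induction N with
    | zero => simp
    | succ N ih =>
      have key : (P ^ N).mulVec h
          = (P ^ N).mulVec (fun _ => (1 : ℝ)) + (P ^ (N + 1)).mulVec h := by
        conv_lhs => rw [hstep]
        rw [Matrix.mulVec_add, Matrix.mulVec_mulVec, ← pow_succ]
      rw [Finset.sum_range_succ, ih, key, Pi.add_apply]
      ring
  have hsum : Summable fun n : ℕ => (P ^ n).mulVec (fun _ => (1 : ℝ)) v := by
    refine summable_of_sum_range_le (c := h v) (fun n => hmul n _ fun _ => zero_le_one) ?_
    intro N
    rw [hpartial N]
    linarith [hmul N h h0]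
  have hle : ∀ N : ℕ, (P ^ N).mulVec h v
      ≤ (∑ w, h w) * (P ^ N).mulVec (fun _ => (1 : ℝ)) v := by
    intro N
    simp only [Matrix.mulVec, dotProduct, mul_one]
    rw [Finset.mul_sum]
    refine Finset.sum_le_sum fun w _ => ?_
    rw [mul_comm]
    exact mul_le_mul_of_nonneg_right
      (Finset.single_le_sum (fun i _ => h0 i) (Finset.mem_univ w)) (hPn N v w)
  have hlim : Filter.Tendsto (fun N : ℕ => (P ^ N).mulVec h v) Filter.atTop (nhds 0) := by
    refine squeeze_zero (fun N => hmul N h h0) hle ?_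
    simpa using hsum.tendsto_atTop_zero.const_mul (∑ w, h w)
  rw [hsum.hasSum_iff_tendsto_nat]
  simp only [hpartial]
  simpa using hlim.const_sub (h v)

/-- Sum of a function over the neighbours of a vertex of the trap path, weighted by the
conductances. -/
theorem sum_trapACond_inr_mul (β : ℝ) (k : ℕ) (j : Fin (k + 1)) (f : ℕ → ℝ) :
    ∑ i : Fin (k + 1), trapACond β k (Sum.inr j) (Sum.inr i) * f i
      = (if (j : ℕ) < k then β ^ ((j : ℕ) + 1) * f (j + 1) else 0)
        + (if 0 < (j : ℕ) then β ^ (j : ℕ) * f (j - 1) else 0) := by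
  obtain ⟨j, hj⟩ := j
  simp only [trapACond]
  rw [Fin.sum_univ_eq_sum_range (fun i : ℕ =>
    (if j + 1 = i ∨ i + 1 = j then β ^ max j i else 0) * f i) (k + 1)]
  have hsplit : ∀ i : ℕ, (if j + 1 = i ∨ i + 1 = j then β ^ max j i else 0) * f i
      = (if j + 1 = i then β ^ (j + 1) * f (j + 1) else 0)
        + (if j - 1 = i then (if 0 < j then β ^ j * f (j - 1) else 0) else 0) := by
    intro i
    by_cases h1 : j + 1 = i
    · subst h1
      have : ¬ j - 1 = j + 1 := by omega
      simp [this]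
    · by_cases h2 : i + 1 = j
      · subst h2
        simp [h1]
      · by_cases h3 : j - 1 = i
        · have : ¬ 0 < j := by omega
          simp [h1, h2, this]
        · simp [h1, h2, h3]
  simp only [hsplit]
  rw [Finset.sum_add_distrib, Finset.sum_ite_eq, Finset.sum_ite_eq]
  have h4 : j - 1 < k + 1 := by omega
  simp [h4]

/-- Total conductance of the trap edges beyond `t_j`. -/
noncomputable def trapATail (β : ℝ) (k j : ℕ) : ℝ := ∑ i ∈ Finset.Ico (j + 1) (k + 1), β ^ i

theorem trapATail_of_lt (β : ℝ) {k j : ℕ} (h : j < k) :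
    trapATail β k j = β ^ (j + 1) + trapATail β k (j + 1) :=
  Finset.sum_eq_sum_Ico_succ_bot (by omega) _

theorem trapATail_self (β : ℝ) (k : ℕ) : trapATail β k k = 0 := by
  simp [trapATail]

theorem trapATail_nonneg {β : ℝ} (hβ : 0 < β) (k j : ℕ) : 0 ≤ trapATail β k j :=
  Finset.sum_nonneg fun _ _ => by positivity

/-- Expected hitting time of `{x₁, x₂}` from the `j`-th vertex of the trap path. -/
noncomputable def trapAPathTime (β : ℝ) (k : ℕ) : ℕ → ℝ
  | 0 => 1 + trapATail β k 0
  | j + 1 => trapAPathTime β k j + (1 + 2 * trapATail β k (j + 1) / β ^ (j + 1))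

theorem trapAPathTime_nonneg {β : ℝ} (hβ : 0 < β) (k j : ℕ) : 0 ≤ trapAPathTime β k j := by
  induction j with
  | zero =>
    have := trapATail_nonneg hβ k 0
    simp only [trapAPathTime]
    positivity
  | succ j ih =>
    have := trapATail_nonneg hβ k (j + 1)
    simp only [trapAPathTime]
    positivity

theorem trapACond_nonneg {β : ℝ} (hβ : 0 < β) (k : ℕ) (v w : Fin 2 ⊕ Fin (k + 1)) :
    0 ≤ trapACond β k v w := by
  rcases v with v | v <;> rcases w with w | w <;> simp only [trapACond] <;>
    positivity

theorem trapAKilled_nonneg {β : ℝ} (hβ : 0 < β) (k : ℕ) (v w : Fin 2 ⊕ Fin (k + 1)) :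
    0 ≤ trapAKilled β k v w := by
  unfold trapAKilled
  split_ifs
  · exact le_rfl
  · exact div_nonneg (trapACond_nonneg hβ k v w)
      (Finset.sum_nonneg fun u _ => trapACond_nonneg hβ k v u)

theorem trapAKilled_mulVec (β : ℝ) (k : ℕ) (h : Fin 2 ⊕ Fin (k + 1) → ℝ)
    (v : Fin 2 ⊕ Fin (k + 1)) :
    (trapAKilled β k).mulVec h v
      = (∑ i, trapACond β k v (Sum.inr i) * h (Sum.inr i)) / ∑ u, trapACond β k v u := by
  rw [Matrix.mulVec, dotProduct, Fintype.sum_sum_type, Finset.sum_div]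
  simp [trapAKilled, div_mul_eq_mul_div]

/-- Expected hitting time of `{x₁, x₂}` at a positive time. -/
noncomputable def trapATime (β : ℝ) (k : ℕ) : Fin 2 ⊕ Fin (k + 1) → ℝ
  | Sum.inl _ => 1 + trapAPathTime β k 0
  | Sum.inr j => trapAPathTime β k j

theorem trapATime_eq {β : ℝ} (hβ : 0 < β) (k : ℕ) (v : Fin 2 ⊕ Fin (k + 1)) :
    trapATime β k v = 1 + (trapAKilled β k).mulVec (trapATime β k) v := by
  rw [trapAKilled_mulVec, Fintype.sum_sum_type]
  rcases v with v | ⟨j, hj⟩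
  · simp [trapATime, trapACond]
  · have hone := sum_trapACond_inr_mul β k ⟨j, hj⟩ fun _ => 1
    simp only [mul_one] at hone
    have htime := sum_trapACond_inr_mul β k ⟨j, hj⟩ (trapAPathTime β k)
    simp only [trapATime]
    rw [hone, htime]
    simp only [trapACond, Fin.sum_univ_two]
    rcases j with _ | j
    · rcases Nat.eq_zero_or_pos k with rfl | hk
      · simp [trapAPathTime, trapATail_self]
      · have h1 := trapATail_of_lt β hk
        simp only [hk, trapAPathTime, h1, if_true, lt_irrefl, if_false]
        field_simp
        ring
    · rcases (Nat.lt_succ_iff.mp hj).eq_or_lt with hk | hk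
      · subst hk
        simp [trapAPathTime, trapATail_self]
        field_simp
        ring
      · have h1 := trapATail_of_lt β hk
        simp only [hk, trapAPathTime, h1, if_true, Nat.succ_ne_zero, if_false,
          Nat.succ_pos, Nat.add_sub_cancel]
        field_simp
        ring

theorem trapAHit_eq {β : ℝ} (hβ : 0 < β) (k : ℕ) :
    trapAHit β k = 1 + ∑ i ∈ Finset.Ico 1 (k + 1), β ^ i := by
  refine (Matrix.hasSum_pow_mulVec_one (trapAKilled β k) (trapAKilled_nonneg hβ k)
    (trapATime β k) ?_ (trapATime_eq hβ k) (Sum.inr 0)).tsum_eq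
  rintro (v | j)
  · exact add_nonneg zero_le_one (trapAPathTime_nonneg hβ k 0)
  · exact trapAPathTime_nonneg hβ k j

/-- the expected time `E[T_k] = E_y[τ_{{x₁,x₂}}] - 1` spent in a trap of
type (a) with `k` edges equals `β(β^k - 1)/(β-1)` for `β ≠ 1`, and `k` for `β = 1`. -/
theorem expected_time_in_trap_type_a (β : ℝ) (hβ : 0 < β) (k : ℕ) (hk : 1 ≤ k) :
    (β ≠ 1 → trapAHit β k - 1 = β * (β ^ k - 1) / (β - 1)) ∧
    (β = 1 → trapAHit β k - 1 = (k : ℝ)) := by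
  rw [trapAHit_eq hβ, add_sub_cancel_left]
  constructor
  · intro h
    rw [geom_sum_Ico h (by omega), pow_succ', pow_one]
    ring
  · rintro rfl
    simp
end

section
/- Trap of type (c): let β > 0 and k, l ≥ 0, and consider the finite graph with vertices x₁, y, x₂, w, left-arm vertices u₁,…,u_l and right-arm vertices t₁,…,t_k, and edges {x₁,y}, {y,x₂} (conductances 1 and β), the edge {y,w} of conductance 1, the left-arm path {w,u₁},…,{u_{l−1},u_l} with conductances β^0, β^{−1}, …, β^{1−l}, and the right-arm path {w,t₁},…,{t_{k−1},t_k} with conductances β, β², …, β^k. Let T_{k,l} be the number of steps the conductance-weighted random walk started at y takes strictly before its first visit to {x₁,x₂}. Then E[T_{k,l}] = (2/(1+β))·(1 + (β/(β−1))·(β^k − β^{−l})) if β ≠ 1, and E[T_{k,l}] = k + l + 1 if β = 1. -/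
open scoped BigOperators

/-- Conductances for a trap of type (c): vertices are `x₁ = Sum.inl 0`, `x₂ = Sum.inl 1`,
`y = Sum.inl 2`, and the trap path indexed by `j ∈ [-l, k]` (`Sum.inr j`), where `j = 0`
is the vertex `w`, negative `j` are the left-arm vertices `u_{-j}` and positive `j` the
right-arm vertices `t_j`.  The edge `{x₁,y}` has conductance `1`, `{y,x₂}` conductance
`β`, `{y,w}` conductance `1`, and the trap path edge between positions `j` and `j+1`
has conductance `β^{j+1}` (so the left arm carries `β⁰, β⁻¹, …, β^{1-l}` and the right
arm `β, β², …, β^k`). -/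
noncomputable def trapCCond (β : ℝ) (k l : ℕ) :
    (Fin 3 ⊕ (Set.Icc (-(l : ℤ)) (k : ℤ))) → (Fin 3 ⊕ (Set.Icc (-(l : ℤ)) (k : ℤ))) → ℝ
  | Sum.inl a, Sum.inl b =>
      if (a = 0 ∧ b = 2) ∨ (a = 2 ∧ b = 0) then 1
      else if (a = 1 ∧ b = 2) ∨ (a = 2 ∧ b = 1) then β else 0
  | Sum.inl a, Sum.inr j => if a = 2 ∧ (j : ℤ) = 0 then 1 else 0
  | Sum.inr j, Sum.inl a => if a = 2 ∧ (j : ℤ) = 0 then 1 else 0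
  | Sum.inr j, Sum.inr j' =>
      if (j : ℤ) + 1 = (j' : ℤ) ∨ (j' : ℤ) + 1 = (j : ℤ)
      then β ^ max (j : ℤ) (j' : ℤ) else 0

/-- The transition matrix of the conductance-weighted walk, killed upon hitting
`{x₁, x₂}`.  Thus `((trapCKilled β k l) ^ n).mulVec 1 y = P_y[τ_{{x₁,x₂}} > n]`. -/
noncomputable def trapCKilled (β : ℝ) (k l : ℕ) :
    Matrix (Fin 3 ⊕ (Set.Icc (-(l : ℤ)) (k : ℤ))) (Fin 3 ⊕ (Set.Icc (-(l : ℤ)) (k : ℤ))) ℝ :=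
  fun v w =>
    if w = Sum.inl 0 ∨ w = Sum.inl 1 then 0
    else trapCCond β k l v w / ∑ u, trapCCond β k l v u

/-- The expected hitting time `E_y[τ_{{x₁,x₂}}] = Σ_{n≥0} P_y[τ > n]` of `{x₁,x₂}`
for the walk started at `y`. -/
noncomputable def trapCHit (β : ℝ) (k l : ℕ) : ℝ :=
  ∑' n : ℕ, ((trapCKilled β k l ^ n).mulVec (fun _ => (1 : ℝ))) (Sum.inl 2)

open Filter Topology

section NonnegMatrix

variable {V : Type*} [Fintype V] [DecidableEq V]

lemma Matrix.pow_mulVec_one_nonneg {K : Matrix V V ℝ} (hK : ∀ a b, 0 ≤ K a b) (n : ℕ) (v : V) :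
    0 ≤ ((K ^ n).mulVec (fun _ => (1 : ℝ))) v := by
  induction n generalizing v with
  | zero => simp
  | succ n ih =>
    rw [pow_succ', ← Matrix.mulVec_mulVec]
    exact Finset.sum_nonneg fun u _ => mul_nonneg (hK v u) (ih u)

/-- Decay of the survival probabilities propagates along positive transitions. -/
lemma Matrix.tendsto_pow_mulVec_one_of_pos {K : Matrix V V ℝ} (hK : ∀ a b, 0 ≤ K a b) {a b : V}
    (hab : 0 < K a b)
    (ha : Tendsto (fun n : ℕ => ((K ^ n).mulVec (fun _ => (1 : ℝ))) a) atTop (𝓝 0)) :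
    Tendsto (fun n : ℕ => ((K ^ n).mulVec (fun _ => (1 : ℝ))) b) atTop (𝓝 0) := by
  have h1 : Tendsto (fun n : ℕ => (K a b)⁻¹ * ((K ^ (n + 1)).mulVec (fun _ => (1 : ℝ))) a)
      atTop (𝓝 0) := by
    simpa using ((tendsto_add_atTop_iff_nat 1).2 ha).const_mul (K a b)⁻¹
  refine squeeze_zero (fun n => Matrix.pow_mulVec_one_nonneg hK n b) (fun n => ?_) h1
  rw [le_inv_mul_iff₀ hab, pow_succ', ← Matrix.mulVec_mulVec]
  exact Finset.single_le_sum
    (f := fun u => K a u * ((K ^ n).mulVec (fun _ => (1 : ℝ))) u)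
    (fun u _ => mul_nonneg (hK a u) (Matrix.pow_mulVec_one_nonneg hK n u)) (Finset.mem_univ b)

/-- A nonnegative solution `μ` of `μ = δ_y + μ K`, supported on the states reachable from `y`,
is the Green function of `K` at `y`; its total mass is the expected lifetime. -/
lemma Matrix.hasSum_pow_mulVec_one_s9 {K : Matrix V V ℝ} (hK : ∀ a b, 0 ≤ K a b) (y : V) {μ : V → ℝ}
    (hμ : ∀ v, 0 ≤ μ v) (hμK : ∀ w, μ w = (if w = y then 1 else 0) + ∑ v, μ v * K v w)
    (hreach : ∀ v, μ v ≠ 0 → Relation.ReflTransGen (fun a b => 0 < K a b) y v) :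
    HasSum (fun n : ℕ => ((K ^ n).mulVec (fun _ => (1 : ℝ))) y) (∑ v, μ v) := by
  set b : ℕ → V → ℝ := fun n => (K ^ n).mulVec (fun _ => (1 : ℝ)) with hb
  have hb0 : ∀ n v, 0 ≤ b n v := Matrix.pow_mulVec_one_nonneg hK
  have hstep : ∀ n, ∑ v, μ v * b n v = b n y + ∑ v, μ v * b (n + 1) v := by
    intro n
    have h1 : ∀ v, b (n + 1) v = ∑ w, K v w * b n w := by
      intro v
      simp only [hb]
      rw [pow_succ', ← Matrix.mulVec_mulVec]
      rfl
    simp only [h1, Finset.mul_sum]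
    rw [Finset.sum_comm]
    conv_lhs => enter [2, w]; rw [hμK w, add_mul, Finset.sum_mul]
    rw [Finset.sum_add_distrib]
    simp [mul_assoc]
  have hpart : ∀ N, ∑ n ∈ Finset.range N, b n y = ∑ v, μ v - ∑ v, μ v * b N v := by
    intro N
    induction N with
    | zero => simp [hb]
    | succ N ih => rw [Finset.sum_range_succ, ih, hstep N]; ring
  have hsum : Summable fun n => b n y := by
    refine summable_of_sum_range_le (c := ∑ v, μ v) (fun n => hb0 n y) fun N => ?_
    rw [hpart]
    have : 0 ≤ ∑ v, μ v * b N v := Finset.sum_nonneg fun v _ => mul_nonneg (hμ v) (hb0 N v)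
    linarith
  have hlim : ∀ v, Relation.ReflTransGen (fun a b => 0 < K a b) y v →
      Tendsto (fun n => b n v) atTop (𝓝 0) := by
    intro v hv
    induction hv with
    | refl => exact hsum.tendsto_atTop_zero
    | tail _ h ih => exact Matrix.tendsto_pow_mulVec_one_of_pos hK h ih
  have hrem : Tendsto (fun N => ∑ v, μ v * b N v) atTop (𝓝 0) := by
    rw [← Finset.sum_const_zero (s := (Finset.univ : Finset V))]
    refine tendsto_finsetSum _ fun v _ => ?_
    by_cases h : μ v = 0
    · simp [h]
    · simpa using (hlim v (hreach v h)).const_mul (μ v)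
  rw [hasSum_iff_tendsto_nat_of_nonneg (fun n => hb0 n y)]
  simp only [hpart]
  simpa using hrem.const_sub (∑ v, μ v)

end NonnegMatrix

section TrapC

variable {β : ℝ} {k l : ℕ}

lemma trapCCond_nonneg (hβ : 0 < β) (v w) : 0 ≤ trapCCond β k l v w := by
  rcases v with a | j <;> rcases w with b | j' <;> simp only [trapCCond] <;> split_ifs <;>
    positivity

lemma trapCCond_comm (v w) : trapCCond β k l v w = trapCCond β k l w v := by
  rcases v with a | j <;> rcases w with b | j'
  · fin_cases a <;> fin_cases b <;> simp [trapCCond]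
  · rfl
  · rfl
  · simp only [trapCCond, max_comm (j : ℤ), or_comm]

lemma trapCKilled_nonneg (hβ : 0 < β) (v w) : 0 ≤ trapCKilled β k l v w := by
  unfold trapCKilled
  split_ifs
  · exact le_rfl
  · exact div_nonneg (trapCCond_nonneg hβ v w)
      (Finset.sum_nonneg fun u _ => trapCCond_nonneg hβ v u)

lemma trapCKilled_pos (hβ : 0 < β) {v w} (hw : ¬(w = Sum.inl 0 ∨ w = Sum.inl 1))
    (h : 0 < trapCCond β k l v w) : 0 < trapCKilled β k l v w := by
  unfold trapCKilled
  rw [if_neg hw]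
  exact div_pos h (h.trans_le (Finset.single_le_sum
    (fun u _ => trapCCond_nonneg hβ v u) (Finset.mem_univ w)))

lemma trapCKilled_reachable_right (hβ : 0 < β) (n : ℕ) (hn : (n : ℤ) ∈ Set.Icc (-(l : ℤ)) k) :
    Relation.ReflTransGen (fun a b => 0 < trapCKilled β k l a b) (Sum.inl 2)
      (Sum.inr ⟨n, hn⟩) := by
  induction n with
  | zero => exact .single (trapCKilled_pos hβ (by simp) (by simp [trapCCond]))
  | succ n ih =>
    have hn' : (n : ℤ) ∈ Set.Icc (-(l : ℤ)) k := by
      simp only [Set.mem_Icc] at hn ⊢; omega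
    refine (ih hn').tail (trapCKilled_pos hβ (by simp) ?_)
    simp only [trapCCond]
    rw [if_pos (Or.inl (by push_cast; rfl))]
    positivity

lemma trapCKilled_reachable_left (hβ : 0 < β) (n : ℕ) (hn : -(n : ℤ) ∈ Set.Icc (-(l : ℤ)) k) :
    Relation.ReflTransGen (fun a b => 0 < trapCKilled β k l a b) (Sum.inl 2)
      (Sum.inr ⟨-n, hn⟩) := by
  induction n with
  | zero => exact .single (trapCKilled_pos hβ (by simp) (by simp [trapCCond]))
  | succ n ih =>
    have hn' : -(n : ℤ) ∈ Set.Icc (-(l : ℤ)) k := by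
      simp only [Set.mem_Icc] at hn ⊢; omega
    refine (ih hn').tail (trapCKilled_pos hβ (by simp) ?_)
    simp only [trapCCond]
    rw [if_pos (Or.inr (by push_cast; ring))]
    positivity

lemma trapCKilled_reachable (hβ : 0 < β) (j : Set.Icc (-(l : ℤ)) (k : ℤ)) :
    Relation.ReflTransGen (fun a b => 0 < trapCKilled β k l a b) (Sum.inl 2) (Sum.inr j) := by
  obtain ⟨j, hj⟩ := j
  obtain ⟨n, rfl | rfl⟩ := j.eq_nat_or_neg
  · exact trapCKilled_reachable_right hβ n hj
  · exact trapCKilled_reachable_left hβ n hj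

/-- The expected hitting time is the total conductance at the vertices other than `x₁, x₂`,
divided by the conductance `1 + β` between `y` and `{x₁, x₂}`. -/
lemma trapCHit_eq_sum_div (hβ : 0 < β) :
    trapCHit β k l = ((∑ u, trapCCond β k l (Sum.inl 2) u) +
      ∑ j, ∑ u, trapCCond β k l (Sum.inr j) u) / (1 + β) := by
  have hβ' : 1 + β ≠ 0 := by positivity
  set C : (Fin 3 ⊕ (Set.Icc (-(l : ℤ)) (k : ℤ))) → ℝ := fun v => ∑ u, trapCCond β k l v u with hC
  have hC0 : ∀ v, 0 ≤ C v := fun v => Finset.sum_nonneg fun u _ => trapCCond_nonneg hβ v u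
  have hCdiv : ∀ v w, C v * (trapCCond β k l v w / C v) = trapCCond β k l v w := by
    intro v w
    by_cases h : C v = 0
    · have := (Finset.sum_eq_zero_iff_of_nonneg
        (fun u _ => trapCCond_nonneg hβ v u)).1 h w (Finset.mem_univ w)
      rw [this, h, zero_mul]
    · field_simp
  have key := Matrix.hasSum_pow_mulVec_one_s9 (trapCKilled_nonneg (k := k) (l := l) hβ) (Sum.inl 2)
    (μ := fun v => if v = Sum.inl 0 ∨ v = Sum.inl 1 then 0 else C v / (1 + β)) ?_ ?_ ?_
  · unfold trapCHit
    rw [key.tsum_eq, Fintype.sum_sum_type, Fin.sum_univ_three]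
    simp [hC, add_div, Finset.sum_div]
  · intro v
    split_ifs
    · exact le_rfl
    · exact div_nonneg (hC0 v) (by positivity)
  · intro w
    by_cases hw : w = Sum.inl 0 ∨ w = Sum.inl 1
    · have h2 : w ≠ Sum.inl 2 := by rintro rfl; simp at hw
      simp [trapCKilled, hw, h2]
    · have hterm : ∀ v, (if v = Sum.inl 0 ∨ v = Sum.inl 1 then 0 else C v / (1 + β)) *
          trapCKilled β k l v w
          = (if v = Sum.inl 0 ∨ v = Sum.inl 1 then 0 else trapCCond β k l v w) / (1 + β) := by
        intro v
        unfold trapCKilled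
        rw [if_neg hw]
        split_ifs
        · simp
        · exact (div_mul_eq_mul_div _ _ _).trans (congrArg (· / (1 + β)) (hCdiv v w))
      have hCw : C w = ∑ v, trapCCond β k l v w :=
        Finset.sum_congr rfl fun v _ => trapCCond_comm w v
      rw [if_neg hw, Finset.sum_congr rfl fun v _ => hterm v, ← Finset.sum_div, hCw,
        Fintype.sum_sum_type, Fintype.sum_sum_type, Fin.sum_univ_three, Fin.sum_univ_three]
      rcases w with a | j
      · fin_cases a
        · simp at hw
        · simp at hw
        · simp [trapCCond]
          field_simp
      · simp [trapCCond]
  · intro v hv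
    rcases v with a | j
    · fin_cases a
      · simp at hv
      · simp at hv
      · exact .refl
    · exact trapCKilled_reachable hβ j

lemma sum_Icc_ite_eq_zero :
    ∑ j : Set.Icc (-(l : ℤ)) (k : ℤ), (if (j : ℤ) = 0 then (1 : ℝ) else 0) = 1 := by
  have h0 : (0 : ℤ) ∈ Set.Icc (-(l : ℤ)) (k : ℤ) := by simp
  rw [Finset.sum_eq_single ⟨0, h0⟩] <;> simp +contextual [Subtype.ext_iff]

lemma sum_trapCCond_y :
    ∑ u, trapCCond β k l (Sum.inl 2) u = 2 + β := by
  rw [Fintype.sum_sum_type, Fin.sum_univ_three]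
  simp [trapCCond, sum_Icc_ite_eq_zero, -Finset.sum_boole]
  ring

/-- Summing an edge function over the edges of the path `[-l, k]` by their right endpoints. -/
lemma sum_Icc_succ_eq (f : ℤ → ℝ) :
    ∑ j : Set.Icc (-(l : ℤ)) (k : ℤ), ∑ j' : Set.Icc (-(l : ℤ)) (k : ℤ),
      (if (j : ℤ) + 1 = (j' : ℤ) then f j' else 0) = ∑ i ∈ Finset.Ioc (-(l : ℤ)) k, f i := by
  have conv (g : ℤ → ℝ) : ∑ j : Set.Icc (-(l : ℤ)) (k : ℤ), g j
      = ∑ i ∈ Finset.Icc (-(l : ℤ)) k, g i :=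
    (Finset.sum_subtype _ (by simp) g).symm
  rw [Finset.sum_comm]
  rw [conv fun j' => ∑ j : Set.Icc (-(l : ℤ)) (k : ℤ), if (j : ℤ) + 1 = j' then f j' else 0]
  have hsub : Finset.Ioc (-(l : ℤ)) k ⊆ Finset.Icc (-(l : ℤ)) k := Finset.Ioc_subset_Icc_self
  rw [← Finset.sum_subset hsub]
  · refine Finset.sum_congr rfl fun i hi => ?_
    rw [conv fun j => if j + 1 = i then f i else 0, Finset.sum_eq_single (i - 1)]
    · simp
    · intro b _ hb
      rw [if_neg (by omega)]
    · intro h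
      simp only [Finset.mem_Icc, Finset.mem_Ioc] at h hi
      omega
  · intro i hi hi'
    refine Finset.sum_eq_zero fun j _ => if_neg ?_
    have := j.2.1
    simp only [Finset.mem_Icc, Finset.mem_Ioc] at hi hi'
    omega

lemma sum_trapCCond_path :
    ∑ j, ∑ u, trapCCond β k l (Sum.inr j) u
      = 1 + 2 * ∑ i ∈ Finset.Ioc (-(l : ℤ)) k, β ^ i := by
  have hsplit : ∀ j j' : Set.Icc (-(l : ℤ)) (k : ℤ), trapCCond β k l (Sum.inr j) (Sum.inr j')
      = (if (j : ℤ) + 1 = j' then β ^ (j' : ℤ) else 0)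
        + (if (j' : ℤ) + 1 = j then β ^ (j : ℤ) else 0) := by
    intro j j'
    simp only [trapCCond]
    by_cases h1 : (j : ℤ) + 1 = j'
    · rw [if_pos (Or.inl h1), if_pos h1, if_neg (by omega), max_eq_right (by omega), add_zero]
    · by_cases h2 : (j' : ℤ) + 1 = j
      · rw [if_pos (Or.inr h2), if_neg h1, if_pos h2, max_eq_left (by omega), zero_add]
      · rw [if_neg (by tauto), if_neg h1, if_neg h2, add_zero]
  have hw : ∀ j : Set.Icc (-(l : ℤ)) (k : ℤ),
      ∑ a : Fin 3, trapCCond β k l (Sum.inr j) (Sum.inl a) = if (j : ℤ) = 0 then 1 else 0 := by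
    intro j
    rw [Fin.sum_univ_three]
    simp [trapCCond]
  simp only [Fintype.sum_sum_type, hw, hsplit, Finset.sum_add_distrib, sum_Icc_ite_eq_zero]
  rw [sum_Icc_succ_eq fun i => β ^ i, Finset.sum_comm, sum_Icc_succ_eq fun i => β ^ i]
  ring

lemma sub_one_mul_sum_zpow_Ioc (hβ : β ≠ 0) (k l : ℕ) :
    (β - 1) * ∑ i ∈ Finset.Ioc (-(l : ℤ)) k, β ^ i = β * (β ^ k - (β ^ l)⁻¹) := by
  have htel : ∀ (n : ℕ) (a : ℤ), (β - 1) * ∑ i ∈ Finset.Ioc a (a + n), β ^ i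
      = β * (β ^ (a + n) - β ^ a) := by
    intro n a
    induction n with
    | zero => simp
    | succ n ih =>
      have : Finset.Ioc a (a + (n + 1 : ℕ)) = insert (a + n + 1) (Finset.Ioc a (a + n)) := by
        ext i
        simp only [Finset.mem_Ioc, Finset.mem_insert]
        omega
      rw [this, Finset.sum_insert (by simp), mul_add, ih, Nat.cast_succ, ← add_assoc,
        zpow_add_one₀ hβ]
      ring
  have := htel (l + k) (-(l : ℤ))
  simpa using this

end TrapC

/-- the expected time `E[T_{k,l}] = E_y[τ_{{x₁,x₂}}] - 1` spent in a trap
of type (c) with `k` right-arm edges and `l` left-arm edges equals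
`(2/(1+β))·(1 + (β/(β-1))·(β^k - β^{-l}))` for `β ≠ 1`, and `k + l + 1` for `β = 1`. -/
theorem expected_time_in_trap_type_c (β : ℝ) (hβ : 0 < β) (k l : ℕ) :
    (β ≠ 1 → trapCHit β k l - 1
        = (2 / (1 + β)) * (1 + (β / (β - 1)) * (β ^ k - (β ^ l)⁻¹))) ∧
    (β = 1 → trapCHit β k l - 1 = (k : ℝ) + (l : ℝ) + 1) := by
  have hβ' : 1 + β ≠ 0 := by positivity
  have hT : trapCHit β k l - 1
      = 2 / (1 + β) * (1 + ∑ i ∈ Finset.Ioc (-(l : ℤ)) k, β ^ i) := by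
    rw [trapCHit_eq_sum_div hβ, sum_trapCCond_y, sum_trapCCond_path]
    field_simp
    ring
  constructor
  · intro h1
    rw [hT, div_mul_eq_mul_div β, ← sub_one_mul_sum_zpow_Ioc hβ.ne',
      mul_div_cancel_left₀ _ (sub_ne_zero.2 h1)]
  · rintro rfl
    rw [hT]
    have : ((k : ℤ) + l).toNat = k + l := by omega
    simp [this]
    ring
end

section
/- Let G = (V,E) be a finite connected graph with strictly positive conductances, and suppose x₁ ≠ x₂ are two vertices each of which has the same vertex y as its unique neighbour. Let τ_{{x₁,x₂}} be the first hitting time of {x₁,x₂} by the conductance-weighted random walk started at y. Then E_y[τ_{{x₁,x₂}}] = 2·(Σ_{e∈E} C(e))/(C({x₁,y}) + C({x₂,y})) − 1. -/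
open scoped BigOperators

/-- Reversibility of the conductance-weighted walk killed on entering `p`: one killed step, paired
with the conductance measure, restricts the integral to the complement of `p`. -/
theorem sum_conductance_mul_killed_step {V : Type*} [Fintype V]
    (Cw : V → V → ℝ) (hsymm : ∀ v w, Cw v w = Cw w v) (hnonneg : ∀ v w, 0 ≤ Cw v w)
    (p : V → Prop) [DecidablePred p] (f : V → ℝ) :
    ∑ v, (∑ u, Cw v u) * ∑ w, (if p w then 0 else Cw v w / ∑ u, Cw v u) * f w
      = ∑ w, if p w then 0 else (∑ u, Cw w u) * f w := by
  have hcancel : ∀ v w, (∑ u, Cw v u) * (Cw v w / ∑ u, Cw v u) = Cw v w := by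
    intro v w
    refine mul_div_cancel_of_imp' fun h => ?_
    exact (Finset.sum_eq_zero_iff_of_nonneg fun u _ => hnonneg v u).1 h w (Finset.mem_univ w)
  simp_rw [Finset.mul_sum]
  rw [Finset.sum_comm]
  refine Finset.sum_congr rfl fun w _ => ?_
  by_cases hw : p w
  · simp [hw]
  · simp only [hw, if_false]
    rw [Finset.sum_mul]
    refine Finset.sum_congr rfl fun v _ => ?_
    rw [← mul_assoc, hcancel, hsymm]



/-- Let `G` be a finite connected graph with strictly positive
conductances `Cw` on its edges (`Cw v w > 0` exactly when `v ~ w`), and let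
`x₁ ≠ x₂` be two vertices each having `y` as unique neighbour.  For the
conductance-weighted random walk started at `y`, the expected hitting time of
`{x₁,x₂}`, written as `Σ_{n≥0} P_y[τ > n]` via the killed transition matrix,
equals `2·(Σ_{e∈E} C(e))/(C(x₁,y) + C(x₂,y)) - 1`, where
`Σ_{e∈E} C(e) = (Σ_v Σ_w Cw v w)/2`. -/
theorem expected_hitting_time_of_two_leaves
    {V : Type*} [Fintype V] [DecidableEq V]
    (Cw : V → V → ℝ) (hsymm : ∀ v w, Cw v w = Cw w v)
    (hnonneg : ∀ v w, 0 ≤ Cw v w) (hloop : ∀ v, Cw v v = 0)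
    (G : SimpleGraph V) (hG : ∀ v w, G.Adj v w ↔ v ≠ w ∧ 0 < Cw v w)
    (hconn : G.Connected)
    (x₁ x₂ y : V) (hx : x₁ ≠ x₂)
    (h₁ : ∀ w, 0 < Cw x₁ w ↔ w = y) (h₂ : ∀ w, 0 < Cw x₂ w ↔ w = y) :
    let Q : Matrix V V ℝ := fun v w =>
      if w = x₁ ∨ w = x₂ then 0 else Cw v w / ∑ u, Cw v u
    ∑' n : ℕ, ((Q ^ n).mulVec (fun _ => (1 : ℝ))) y
      = 2 * ((∑ v, ∑ w, Cw v w) / 2) / (Cw x₁ y + Cw x₂ y) - 1 := by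
  intro Q
  set C : V → ℝ := fun v => ∑ u, Cw v u with hC
  set a : ℕ → V → ℝ := fun n => (Q ^ n).mulVec (fun _ => (1 : ℝ)) with ha
  have hCnonneg : ∀ v, 0 ≤ C v := fun v => Finset.sum_nonneg fun u _ => hnonneg v u
  have hQnonneg : ∀ v w, 0 ≤ Q v w := by
    intro v w
    change 0 ≤ if w = x₁ ∨ w = x₂ then 0 else Cw v w / C v
    split_ifs
    exacts [le_rfl, div_nonneg (hnonneg v w) (hCnonneg v)]
  have ha_zero : ∀ v, a 0 v = 1 := fun v => by simp [ha]
  have ha_succ : ∀ n v, a (n + 1) v = ∑ w, Q v w * a n w := by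
    intro n v
    simp only [ha, pow_succ', ← Matrix.mulVec_mulVec]
    rfl
  have ha_nonneg : ∀ n v, 0 ≤ a n v := by
    intro n
    induction n with
    | zero => intro v; rw [ha_zero]; exact zero_le_one
    | succ n ih =>
      intro v
      rw [ha_succ]
      exact Finset.sum_nonneg fun w _ => mul_nonneg (hQnonneg v w) (ih w)
  have hleaf : ∀ x, (∀ w, 0 < Cw x w ↔ w = y) → 0 < Cw x y ∧ x ≠ y ∧
      (∀ w, w ≠ y → Cw x w = 0) ∧ C x = Cw x y := by
    intro x h
    have hpos : 0 < Cw x y := (h y).2 rfl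
    have hzero : ∀ w, w ≠ y → Cw x w = 0 := fun w hw =>
      le_antisymm (not_lt.1 fun hlt => hw ((h w).1 hlt)) (hnonneg x w)
    refine ⟨hpos, ?_, hzero, Finset.sum_eq_single y (fun w _ hw => hzero w hw) (by simp)⟩
    rintro rfl
    exact hpos.ne' (hloop x)
  obtain ⟨hpos₁, hne₁, hzero₁, hC₁⟩ := hleaf x₁ h₁
  obtain ⟨hpos₂, hne₂, hzero₂, hC₂⟩ := hleaf x₂ h₂
  have ha_leaf : ∀ x, (∀ w, 0 < Cw x w ↔ w = y) → ∀ n, a (n + 1) x = a n y := by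
    intro x h n
    obtain ⟨hpos, -, hzero, hCx⟩ := hleaf x h
    rw [ha_succ, Finset.sum_eq_single y _ (by simp)]
    · change (if y = x₁ ∨ y = x₂ then 0 else Cw x y / C x) * a n y = a n y
      rw [if_neg (by simp [hne₁.symm, hne₂.symm]), hCx, div_self hpos.ne', one_mul]
    · intro w _ hw
      change (if w = x₁ ∨ w = x₂ then 0 else Cw x w / C x) * a n w = 0
      rw [hzero w hw]
      simp
  set b : ℕ → ℝ := fun n => ∑ v, C v * a n v with hb
  have hb_nonneg : ∀ n, 0 ≤ b n := fun n =>
    Finset.sum_nonneg fun v _ => mul_nonneg (hCnonneg v) (ha_nonneg n v)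
  have hb_succ : ∀ n, b (n + 1) = b n - (Cw x₁ y * a n x₁ + Cw x₂ y * a n x₂) := by
    intro n
    have hstep : b (n + 1) = ∑ w, if w = x₁ ∨ w = x₂ then 0 else C w * a n w := by
      simp only [hb, ha_succ]
      exact sum_conductance_mul_killed_step Cw hsymm hnonneg (fun w => w = x₁ ∨ w = x₂) (a n)
    have hsplit : ∀ w, (if w = x₁ ∨ w = x₂ then 0 else C w * a n w) = C w * a n w -
        ((if w = x₁ then C w * a n w else 0) + if w = x₂ then C w * a n w else 0) := by
      intro w
      by_cases hw₁ : w = x₁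
      · simp [hw₁, hx]
      · by_cases hw₂ : w = x₂ <;> simp [hw₁, hw₂, hx.symm]
    rw [hstep, Finset.sum_congr rfl fun w _ => hsplit w, Finset.sum_sub_distrib,
      Finset.sum_add_distrib, Finset.sum_ite_eq' Finset.univ x₁, Finset.sum_ite_eq' Finset.univ x₂]
    simp only [Finset.mem_univ, if_true, hC₁, hC₂, hb]
  have hpartial : ∀ N, b (N + 1) = ∑ v, C v -
      (Cw x₁ y + Cw x₂ y) * (1 + ∑ n ∈ Finset.range N, a n y) := by
    intro N
    induction N with
    | zero =>
      rw [hb_succ, ha_zero, ha_zero]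
      simp [hb, ha_zero]
    | succ N ih =>
      rw [hb_succ, ih, ha_leaf x₁ h₁, ha_leaf x₂ h₂, Finset.sum_range_succ]
      ring
  have hK : 0 < Cw x₁ y + Cw x₂ y := add_pos hpos₁ hpos₂
  have hformula : ∀ N, ∑ n ∈ Finset.range N, a n y =
      (∑ v, C v - b (N + 1)) / (Cw x₁ y + Cw x₂ y) - 1 := by
    intro N
    rw [hpartial]
    field_simp
    ring
  have hsummable : Summable fun n => a n y := by
    refine summable_of_sum_range_le (c := (∑ v, C v) / (Cw x₁ y + Cw x₂ y) - 1)
      (fun n => ha_nonneg n y) fun N => ?_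
    rw [hformula]
    gcongr
    exact sub_le_self _ (hb_nonneg _)
  have htendsto_adj : ∀ v w, G.Adj v w → Filter.Tendsto (fun n => a n v) Filter.atTop (nhds 0) →
      Filter.Tendsto (fun n => a n w) Filter.atTop (nhds 0) := by
    intro v w hvw hv
    have hpos : 0 < Cw v w := ((hG v w).1 hvw).2
    have hleaf_case : (∀ u, 0 < Cw w u ↔ u = y) →
        Filter.Tendsto (fun n => a n w) Filter.atTop (nhds 0) := by
      intro h
      have hvy : v = y := (h v).1 (hsymm v w ▸ hpos)
      rw [← Filter.tendsto_add_atTop_iff_nat 1]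
      simpa only [ha_leaf w h, ← hvy] using hv
    by_cases hw₁ : w = x₁
    · exact hleaf_case (hw₁ ▸ h₁)
    by_cases hw₂ : w = x₂
    · exact hleaf_case (hw₂ ▸ h₂)
    have hQ : 0 < Q v w := by
      change 0 < if w = x₁ ∨ w = x₂ then 0 else Cw v w / C v
      rw [if_neg (by simp [hw₁, hw₂])]
      exact div_pos hpos (hpos.trans_le
        (Finset.single_le_sum (fun u _ => hnonneg v u) (Finset.mem_univ w)))
    have hlim : Filter.Tendsto (fun n => a (n + 1) v / Q v w) Filter.atTop (nhds 0) := by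
      simpa using ((Filter.tendsto_add_atTop_iff_nat 1).2 hv).div_const (Q v w)
    refine squeeze_zero (fun n => ha_nonneg n w) (fun n => ?_) hlim
    rw [le_div_iff₀' hQ, ha_succ]
    exact Finset.single_le_sum (f := fun u => Q v u * a n u)
      (fun u _ => mul_nonneg (hQnonneg v u) (ha_nonneg n u)) (Finset.mem_univ w)
  have htendsto : ∀ v, Filter.Tendsto (fun n => a n v) Filter.atTop (nhds 0) := by
    have hwalk : ∀ {u v : V}, G.Walk u v →
        Filter.Tendsto (fun n => a n u) Filter.atTop (nhds 0) →
        Filter.Tendsto (fun n => a n v) Filter.atTop (nhds 0) := by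
      intro u v q
      induction q with
      | nil => exact id
      | cons h _ ih => exact fun hu => ih (htendsto_adj _ _ h hu)
    intro v
    obtain ⟨q⟩ := hconn.preconnected y v
    exact hwalk q hsummable.tendsto_atTop_zero
  have hb_tendsto : Filter.Tendsto b Filter.atTop (nhds 0) := by
    simpa using tendsto_finsetSum Finset.univ fun v _ => (htendsto v).const_mul (C v)
  have hlimit : Filter.Tendsto (fun N => ∑ n ∈ Finset.range N, a n y) Filter.atTop
      (nhds ((∑ v, C v) / (Cw x₁ y + Cw x₂ y) - 1)) := by
    simp_rw [hformula]
    simpa using ((((Filter.tendsto_add_atTop_iff_nat 1).2 hb_tendsto).const_sub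
      (∑ v, C v)).div_const (Cw x₁ y + Cw x₂ y)).sub_const 1
  rw [mul_div_cancel₀ _ (two_ne_zero' ℝ)]
  exact ((hasSum_iff_tendsto_nat_of_nonneg (fun n => ha_nonneg n y) _).2 hlimit).tsum_eq
end

section
/- Let β > 1 and let (c_m)_{m ≥ n−1} be strictly positive reals such that for every m, c_{m+1} ∈ {c_m, β·c_m}, and such that whenever c_{m+1} = c_m (with m ≥ n) one has c_m = β·c_{m−1}. Then the series R := Σ_{m=n}^∞ 1/c_m converges and the quantity p := [ (c_{n−1} + c_n)·R ]^{−1} satisfies (1/2)·(β−1)/(β+1) ≤ p ≤ (β−1)/(β+1). -/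
/-- If `a (m + 2) ≥ β * a m` throughout, the partial sums of `1 / a (m + 1)` are bounded by the
potential `(1 / a 0 + β / a 1) / (β - 1)`. -/
theorem sum_range_inv_le_of_two_step_growth {β : ℝ} (hβ : 1 < β) {a : ℕ → ℝ}
    (hpos : ∀ m, 0 < a m) (hgrow : ∀ m, β * a m ≤ a (m + 2)) (N : ℕ) :
    ∑ m ∈ Finset.range N, (a (m + 1))⁻¹ ≤ ((a 0)⁻¹ + β * (a 1)⁻¹) / (β - 1) := by
  have hβ' : 0 < β - 1 := sub_pos.mpr hβ
  have key : (β - 1) * ∑ m ∈ Finset.range N, (a (m + 1))⁻¹ + ((a N)⁻¹ + β * (a (N + 1))⁻¹)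
      ≤ (a 0)⁻¹ + β * (a 1)⁻¹ := by
    induction N with
    | zero => simp
    | succ N ih =>
      have h : β * (a (N + 2))⁻¹ ≤ (a N)⁻¹ := by
        rw [← div_eq_mul_inv, inv_eq_one_div, div_le_div_iff₀ (hpos _) (hpos _), one_mul]
        exact hgrow N
      rw [Finset.sum_range_succ, show N + 1 + 1 = N + 2 from rfl]
      linarith
  rw [le_div_iff₀ hβ']
  have h₁ := inv_pos.mpr (hpos N)
  have h₂ := mul_pos (zero_lt_one.trans hβ) (inv_pos.mpr (hpos (N + 1)))
  linarith

/-- A summable series whose terms shrink by at most a factor `β` at each step dominates the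
geometric series with the same first term. -/
theorem mul_div_le_tsum_of_le_mul_succ {β : ℝ} (hβ : 1 < β) {f : ℕ → ℝ} (hf : Summable f)
    (hstep : ∀ m, f m ≤ β * f (m + 1)) : β * f 0 / (β - 1) ≤ ∑' m, f m := by
  have htail : Summable fun m => f (m + 1) := (summable_nat_add_iff 1).mpr hf
  have hle := hf.tsum_le_tsum hstep (htail.mul_left β)
  rw [tsum_mul_left] at hle
  have hsplit := hf.tsum_eq_zero_add
  rw [div_le_iff₀ (sub_pos.mpr hβ)]
  linear_combination hle - β * hsplit

/-- Bounds on the escape probability along the ray.  Here `c 0` plays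
the role of `c_{n-1}` and `c (m+1)` the role of `c_{n+m}`: each conductance along the
ray either repeats or is multiplied by `β`, and a repeat at an index `≥ n` is always
preceded by a multiplication by `β`.  Then the effective resistance
`R = Σ_{m≥n} 1/c_m` converges and `p = [(c_{n-1}+c_n)·R]⁻¹` satisfies
`(1/2)·(β-1)/(β+1) ≤ p ≤ (β-1)/(β+1)`. -/
theorem escape_probability_bounds_on_ray
    (β : ℝ) (hβ : 1 < β) (c : ℕ → ℝ)
    (hpos : ∀ m, 0 < c m)
    (hstep : ∀ m, c (m + 1) = c m ∨ c (m + 1) = β * c m)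
    (hrep : ∀ m, 1 ≤ m → c (m + 1) = c m → c m = β * c (m - 1)) :
    Summable (fun m : ℕ => (c (m + 1))⁻¹) ∧
    (1 / 2) * ((β - 1) / (β + 1)) ≤ ((c 0 + c 1) * ∑' m : ℕ, (c (m + 1))⁻¹)⁻¹ ∧
    ((c 0 + c 1) * ∑' m : ℕ, (c (m + 1))⁻¹)⁻¹ ≤ (β - 1) / (β + 1) := by
  have hβ₀ : 0 < β := zero_lt_one.trans hβ
  have hβ' : 0 < β - 1 := sub_pos.mpr hβ
  have hup : ∀ m, c (m + 1) ≤ β * c m := fun m => by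
    rcases hstep m with h | h <;> nlinarith [hpos m]
  have hmono : ∀ m, c m ≤ c (m + 1) := fun m => by
    rcases hstep m with h | h <;> nlinarith [hpos m]
  have hgrow : ∀ m, β * c m ≤ c (m + 2) := fun m => by
    rcases hstep (m + 1) with h | h
    · have hprev : c (m + 1) = β * c m := hrep (m + 1) (Nat.le_add_left 1 m) h
      exact (h.trans hprev).ge
    · exact (mul_le_mul_of_nonneg_left (hmono m) hβ₀.le).trans h.ge
  have hbound := sum_range_inv_le_of_two_step_growth hβ hpos hgrow
  have hnonneg : ∀ m, 0 ≤ (c (m + 1))⁻¹ := fun m => (inv_pos.mpr (hpos _)).le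
  have hsum : Summable fun m : ℕ => (c (m + 1))⁻¹ := summable_of_sum_range_le hnonneg hbound
  have hR_le := Real.tsum_le_of_sum_range_le hnonneg hbound
  have hle_R := mul_div_le_tsum_of_le_mul_succ hβ hsum fun m => by
    rw [← div_eq_mul_inv, inv_eq_one_div, div_le_div_iff₀ (hpos _) (hpos _), one_mul]
    exact hup (m + 1)
  rw [zero_add] at hle_R
  have h₀ := hpos 0
  have h₁ := hpos 1
  have hc : 0 < c 0 + c 1 := add_pos h₀ h₁
  have hlower : (β + 1) / (β - 1) ≤ (c 0 + c 1) * ∑' m : ℕ, (c (m + 1))⁻¹ := by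
    refine le_trans ?_ (mul_le_mul_of_nonneg_left hle_R hc.le)
    rw [mul_div_assoc', div_le_div_iff_of_pos_right hβ', ← div_eq_mul_inv, mul_div_assoc',
      le_div_iff₀ h₁]
    linarith [hup 0]
  have hupper : (c 0 + c 1) * ∑' m : ℕ, (c (m + 1))⁻¹ ≤ 2 * ((β + 1) / (β - 1)) := by
    refine (mul_le_mul_of_nonneg_left hR_le hc.le).trans (le_of_eq ?_)
    rcases hstep 0 with h | h <;> rw [zero_add] at h <;> rw [h] <;> field_simp <;> ring
  have hq : 0 < (β + 1) / (β - 1) := div_pos (by linarith) hβ'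
  refine ⟨hsum, ?_, ?_⟩
  · rw [← inv_div (β + 1), one_div, ← mul_inv]
    exact inv_anti₀ (hq.trans_le hlower) hupper
  · rw [← inv_div (β + 1)]
    exact inv_anti₀ hq hlower
end
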